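/- arXiv:2012.15468 — 2 statements merged into one kernel-verified Lean document; each statement's English description precedes it below -/
import Mathlib

section
/- Suppose there exist N₁ ≥ 1 and a constant c₁ > 0 such that for every N ≥ N₁ the rescaled system (ODE-Λ^N) has a solution (Λ₁^N, Λ₂^N) on [0, T] satisfying sup_{N ≥ N₁} sup_{t∈[0,T]} (|Λ₁^N(t)| + |Λ₂^N(t)|) < ∞ (|·| the Frobenius norm) and ℛ₁(Λ₁^N(t)) ≥ c₁ I, ℛ₂(Λ₁^N(t), Λ₂^N(t)) ≥ c₁ I for all t ∈ [0,T]. Then the LQ mean field social optimization problem has asymptotic solvability. -/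
open Matrix Set

namespace LQ

/-- Frobenius norm of a real matrix. -/
noncomputable def frob {a b : Type*} [Fintype a] [Fintype b] (M : Matrix a b ℝ) : ℝ :=
  Real.sqrt (∑ i, ∑ j, (M i j) ^ 2)

/-- Entrywise ℓ₁ norm of a real matrix. -/
noncomputable def l1norm {a b : Type*} [Fintype a] [Fintype b] (M : Matrix a b ℝ) : ℝ :=
  ∑ i, ∑ j, |M i j|

/-- Block matrix with all diagonal m×m blocks equal to `F` and all off-diagonal blocks equal to `K`. -/
def blockConst (N m : ℕ) (F K : Matrix (Fin m) (Fin m) ℝ) :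
    Matrix (Fin N × Fin m) (Fin N × Fin m) ℝ :=
  Matrix.of fun x y => if x.1 = y.1 then F x.2 y.2 else K x.2 y.2

/-- Block matrix with diagonal blocks `Λ₁` and off-diagonal blocks `Λ₂ / N`. -/
noncomputable def blockPN (N n : ℕ) (Λ₁ Λ₂ : Matrix (Fin n) (Fin n) ℝ) :
    Matrix (Fin N × Fin n) (Fin N × Fin n) ℝ :=
  Matrix.of fun x y => if x.1 = y.1 then Λ₁ x.2 y.2 else Λ₂ x.2 y.2 / (N : ℝ)

/-- The permutation matrix exchanging the i-th and j-th block rows of `I_{Nn}`. -/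
def Jswap (N n : ℕ) (i j : Fin N) : Matrix (Fin N × Fin n) (Fin N × Fin n) ℝ :=
  Matrix.of fun x y => if y.1 = Equiv.swap i j x.1 ∧ y.2 = x.2 then 1 else 0

/-- `I_N ⊗ M`. -/
def kronIN (N : ℕ) {a b : ℕ} (M : Matrix (Fin a) (Fin b) ℝ) :
    Matrix (Fin N × Fin a) (Fin N × Fin b) ℝ :=
  Matrix.of fun x y => if x.1 = y.1 then M x.2 y.2 else 0

/-- `𝟏_{N×1} ⊗ M`. -/
def stackN (N : ℕ) {a b : ℕ} (M : Matrix (Fin a) (Fin b) ℝ) :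
    Matrix (Fin N × Fin a) (Fin b) ℝ :=
  Matrix.of fun x y => M x.2 y

/-- Data of the LQ mean field social optimization problem. -/
structure Params (n n₁ : ℕ) where
  A : Matrix (Fin n) (Fin n) ℝ
  G : Matrix (Fin n) (Fin n) ℝ
  Γ : Matrix (Fin n) (Fin n) ℝ
  Γf : Matrix (Fin n) (Fin n) ℝ
  B : Matrix (Fin n) (Fin n₁) ℝ
  B0 : Matrix (Fin n) (Fin n₁) ℝ
  B1 : Matrix (Fin n) (Fin n₁) ℝ
  D : Matrix (Fin n) (Fin 1) ℝ
  D0 : Matrix (Fin n) (Fin 1) ℝ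
  Q : Matrix (Fin n) (Fin n) ℝ
  Qf : Matrix (Fin n) (Fin n) ℝ
  R : Matrix (Fin n₁) (Fin n₁) ℝ
  T : ℝ

namespace Params

variable {n n₁ : ℕ} (p : Params n n₁)

/-- Standing hypotheses: positive dimensions, positive horizon, symmetric weights. -/
def Standing : Prop :=
  1 ≤ n ∧ 1 ≤ n₁ ∧ 0 < p.T ∧ p.Q.IsSymm ∧ p.Qf.IsSymm ∧ p.R.IsSymm

/-- Q^Γ = Γᵀ Q Γ − Q Γ − Γᵀ Q. -/
def QΓ : Matrix (Fin n) (Fin n) ℝ := p.Γᵀ * p.Q * p.Γ - p.Q * p.Γ - p.Γᵀ * p.Q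

/-- Q_f^Γ = Γ_fᵀ Q_f Γ_f − Q_f Γ_f − Γ_fᵀ Q_f. -/
def QfΓ : Matrix (Fin n) (Fin n) ℝ := p.Γfᵀ * p.Qf * p.Γf - p.Qf * p.Γf - p.Γfᵀ * p.Qf

/-- ℛ₁(Λ₁) = R + B₁ᵀ Λ₁ B₁. -/
def R1 (Λ₁ : Matrix (Fin n) (Fin n) ℝ) : Matrix (Fin n₁) (Fin n₁) ℝ :=
  p.R + p.B1ᵀ * Λ₁ * p.B1

/-- ℛ₂(Λ₁,Λ₂) = R + B₁ᵀ Λ₁ B₁ + B₀ᵀ(Λ₁+Λ₂)B₀. -/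
def R2 (Λ₁ Λ₂ : Matrix (Fin n) (Fin n) ℝ) : Matrix (Fin n₁) (Fin n₁) ℝ :=
  p.R + p.B1ᵀ * Λ₁ * p.B1 + p.B0ᵀ * (Λ₁ + Λ₂) * p.B0

/-- Ψ₁. -/
noncomputable def Ψ₁ (Λ₁ : Matrix (Fin n) (Fin n) ℝ) : Matrix (Fin n) (Fin n) ℝ :=
  Λ₁ * p.B * (p.R1 Λ₁)⁻¹ * p.Bᵀ * Λ₁ - Λ₁ * p.A - p.Aᵀ * Λ₁ - p.Q

/-- Ψ₂. -/
noncomputable def Ψ₂ (Λ₁ Λ₂ : Matrix (Fin n) (Fin n) ℝ) : Matrix (Fin n) (Fin n) ℝ :=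
  (Λ₁ + Λ₂) * p.B * (p.R2 Λ₁ Λ₂)⁻¹ * p.Bᵀ * (Λ₁ + Λ₂)
    - Λ₁ * p.B * (p.R1 Λ₁)⁻¹ * p.Bᵀ * Λ₁
    - (Λ₁ * p.G + Λ₂ * (p.A + p.G))
    - (p.Gᵀ * Λ₁ + (p.Aᵀ + p.Gᵀ) * Λ₂)
    - p.QΓ

/-- Solution of the limiting ODE system (ODE-Λ) on [0,T]. -/
noncomputable def IsSolLim (Λ₁ Λ₂ : ℝ → Matrix (Fin n) (Fin n) ℝ) : Prop :=
  (∀ t ∈ Icc (0 : ℝ) p.T, (Λ₁ t).IsSymm ∧ (Λ₂ t).IsSymm) ∧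
  (∀ t ∈ Icc (0 : ℝ) p.T, (p.R1 (Λ₁ t)).PosDef ∧ (p.R2 (Λ₁ t) (Λ₂ t)).PosDef) ∧
  Λ₁ p.T = p.Qf ∧ Λ₂ p.T = p.QfΓ ∧
  (∀ t ∈ Icc (0 : ℝ) p.T, ∀ i j, HasDerivWithinAt (fun s => Λ₁ s i j)
    (p.Ψ₁ (Λ₁ t) i j) (Icc (0 : ℝ) p.T) t) ∧
  (∀ t ∈ Icc (0 : ℝ) p.T, ∀ i j, HasDerivWithinAt (fun s => Λ₂ s i j)
    (p.Ψ₂ (Λ₁ t) (Λ₂ t) i j) (Icc (0 : ℝ) p.T) t)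

/-! Big (N-agent) matrices. -/

noncomputable def bigA (N : ℕ) : Matrix (Fin N × Fin n) (Fin N × Fin n) ℝ :=
  Matrix.of fun x y => (if x.1 = y.1 then p.A x.2 y.2 else 0) + p.G x.2 y.2 / (N : ℝ)

def bigBhat (N : ℕ) : Matrix (Fin N × Fin n) (Fin N × Fin n₁) ℝ :=
  Matrix.of fun x y => if x.1 = y.1 then p.B x.2 y.2 else 0

def bigB (N : ℕ) (i : Fin N) : Matrix (Fin N × Fin n) (Fin n₁) ℝ :=
  Matrix.of fun x l => if x.1 = i then p.B1 x.2 l else 0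

noncomputable def bigB0 (N : ℕ) : Matrix (Fin N × Fin n) (Fin n₁) ℝ :=
  Matrix.of fun x l => p.B0 x.2 l / (N : ℝ)

def bigD (N : ℕ) (i : Fin N) : Matrix (Fin N × Fin n) (Fin 1) ℝ :=
  Matrix.of fun x l => if x.1 = i then p.D x.2 l else 0

def bigD0 (N : ℕ) : Matrix (Fin N × Fin n) (Fin 1) ℝ :=
  Matrix.of fun x l => p.D0 x.2 l

def bigE (_p : Params n n₁) (N : ℕ) (i : Fin N) : Matrix (Fin n₁) (Fin N × Fin n₁) ℝ :=
  Matrix.of fun k y => if y.1 = i ∧ y.2 = k then 1 else 0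

def bigIhat (_p : Params n n₁) (N : ℕ) : Matrix (Fin n₁) (Fin N × Fin n₁) ℝ :=
  Matrix.of fun k y => if y.2 = k then 1 else 0

noncomputable def bigQ (N : ℕ) : Matrix (Fin N × Fin n) (Fin N × Fin n) ℝ :=
  Matrix.of fun x y => (if x.1 = y.1 then p.Q x.2 y.2 else 0) + p.QΓ x.2 y.2 / (N : ℝ)

noncomputable def bigQf (N : ℕ) : Matrix (Fin N × Fin n) (Fin N × Fin n) ℝ :=
  Matrix.of fun x y => (if x.1 = y.1 then p.Qf x.2 y.2 else 0) + p.QfΓ x.2 y.2 / (N : ℝ)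

def bigR (N : ℕ) : Matrix (Fin N × Fin n₁) (Fin N × Fin n₁) ℝ :=
  Matrix.of fun x y => if x.1 = y.1 then p.R x.2 y.2 else 0

/-- 𝓜₀. -/
noncomputable def M0 (N : ℕ) (Z : Matrix (Fin N × Fin n) (Fin N × Fin n) ℝ) :
    Matrix (Fin 1) (Fin 1) ℝ :=
  (1 / 2 : ℝ) • (∑ i : Fin N, (p.bigD N i)ᵀ * Z * p.bigD N i)
    + (1 / 2 : ℝ) • ((p.bigD0 N)ᵀ * Z * p.bigD0 N)

/-- 𝓜₁. -/
noncomputable def M1 (N : ℕ) (Z : Matrix (Fin N × Fin n) (Fin N × Fin n) ℝ) :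
    Matrix (Fin 1) (Fin N × Fin n₁) ℝ :=
  (∑ i : Fin N, (p.bigD N i)ᵀ * Z * p.bigB N i * p.bigE N i)
    + (p.bigD0 N)ᵀ * Z * p.bigB0 N * p.bigIhat N

/-- 𝓜₂. -/
noncomputable def M2 (N : ℕ) (Z : Matrix (Fin N × Fin n) (Fin N × Fin n) ℝ) :
    Matrix (Fin N × Fin n₁) (Fin N × Fin n₁) ℝ :=
  (1 / 2 : ℝ) • (∑ i : Fin N, (p.bigE N i)ᵀ * (p.bigB N i)ᵀ * Z * p.bigB N i * p.bigE N i)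
    + (1 / 2 : ℝ) • ((p.bigIhat N)ᵀ * (p.bigB0 N)ᵀ * Z * p.bigB0 N * p.bigIhat N)

/-- Right-hand side of the Riccati equation (ODE-P). -/
noncomputable def PRic (N : ℕ) (P : Matrix (Fin N × Fin n) (Fin N × Fin n) ℝ) :
    Matrix (Fin N × Fin n) (Fin N × Fin n) ℝ :=
  P * p.bigBhat N * (p.bigR N + (2 : ℝ) • p.M2 N P)⁻¹ * (p.bigBhat N)ᵀ * P
    - P * p.bigA N - (p.bigA N)ᵀ * P - p.bigQ N

/-- Solution of the large-scale Riccati equation (ODE-P) on [0,T]. -/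
noncomputable def IsSolP (N : ℕ) (P : ℝ → Matrix (Fin N × Fin n) (Fin N × Fin n) ℝ) : Prop :=
  (∀ t ∈ Icc (0 : ℝ) p.T, (P t).IsSymm) ∧
  (∀ t ∈ Icc (0 : ℝ) p.T, (p.bigR N + (2 : ℝ) • p.M2 N (P t)).PosDef) ∧
  P p.T = p.bigQf N ∧
  (∀ t ∈ Icc (0 : ℝ) p.T, ∀ x y, HasDerivWithinAt (fun s => P s x y)
    (p.PRic N (P t) x y) (Icc (0 : ℝ) p.T) t)

/-- Solution of the companion linear equation (ODE-S) on [0,T], relative to `P`. -/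
noncomputable def IsSolS (N : ℕ) (P : ℝ → Matrix (Fin N × Fin n) (Fin N × Fin n) ℝ)
    (S : ℝ → Matrix (Fin N × Fin n) (Fin 1) ℝ) : Prop :=
  S p.T = 0 ∧
  (∀ t ∈ Icc (0 : ℝ) p.T, ∀ x y, HasDerivWithinAt (fun s => S s x y)
    ((P t * p.bigBhat N * (p.bigR N + (2 : ℝ) • p.M2 N (P t))⁻¹ *
        ((p.bigBhat N)ᵀ * S t + (p.M1 N (P t))ᵀ) - (p.bigA N)ᵀ * S t) x y)
    (Icc (0 : ℝ) p.T) t)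

/-- Solution of the companion scalar equation (ODE-r) on [0,T], relative to `P` and `S`. -/
noncomputable def IsSolr (N : ℕ) (P : ℝ → Matrix (Fin N × Fin n) (Fin N × Fin n) ℝ)
    (S : ℝ → Matrix (Fin N × Fin n) (Fin 1) ℝ) (r : ℝ → ℝ) : Prop :=
  r p.T = 0 ∧
  (∀ t ∈ Icc (0 : ℝ) p.T, HasDerivWithinAt r
    (((((S t)ᵀ * p.bigBhat N + p.M1 N (P t)) * (p.bigR N + (2 : ℝ) • p.M2 N (P t))⁻¹ *
        ((p.bigBhat N)ᵀ * S t + (p.M1 N (P t))ᵀ)) - (2 : ℝ) • p.M0 N (P t)) 0 0)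
    (Icc (0 : ℝ) p.T) t)

/-- Asymptotic solvability of the LQ mean field social optimization problem. -/
noncomputable def AsympSolvable : Prop :=
  ∃ N₀ : ℕ, 1 ≤ N₀ ∧ ∃ c₀ : ℝ, 0 < c₀ ∧ ∃ C : ℝ,
    ∀ N : ℕ, N₀ ≤ N →
      ∃ P : ℝ → Matrix (Fin N × Fin n) (Fin N × Fin n) ℝ,
        p.IsSolP N P ∧
        (∀ t ∈ Icc (0 : ℝ) p.T, l1norm (P t) / (N : ℝ) ≤ C) ∧
        (∀ t ∈ Icc (0 : ℝ) p.T,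
          (p.bigR N + (2 : ℝ) • p.M2 N (P t) - c₀ • 1).PosSemidef)

/-! The rescaled low-dimensional system. -/

/-- E^N. -/
noncomputable def EN (N : ℕ) (Λ₁ Λ₂ : Matrix (Fin n) (Fin n) ℝ) :
    Matrix (Fin n₁) (Fin n₁) ℝ :=
  (1 / (N : ℝ)) •
    ((p.R2 Λ₁ Λ₂ - (1 / (N : ℝ)) • (p.B0ᵀ * Λ₂ * p.B0))⁻¹ - (p.R1 Λ₁)⁻¹)

/-- H^N. -/
noncomputable def HN (N : ℕ) (Λ₁ Λ₂ : Matrix (Fin n) (Fin n) ℝ) :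
    Matrix (Fin n₁) (Fin n₁) ℝ :=
  p.EN N Λ₁ Λ₂ + (p.R1 Λ₁)⁻¹

/-- g₁. -/
noncomputable def g₁ (N : ℕ) (Λ₁ Λ₂ : Matrix (Fin n) (Fin n) ℝ) :
    Matrix (Fin n) (Fin n) ℝ :=
  Λ₁ * p.B * p.EN N Λ₁ Λ₂ * p.Bᵀ * Λ₁
  + (1 - 1 / (N : ℝ)) •
      (Λ₂ * p.B * p.EN N Λ₁ Λ₂ * p.Bᵀ * Λ₁ + Λ₁ * p.B * p.EN N Λ₁ Λ₂ * p.Bᵀ * Λ₂)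
  + (1 / (N : ℝ) - 1 / (N : ℝ) ^ 2) •
      (Λ₂ * p.B * (p.HN N Λ₁ Λ₂ + ((N : ℝ) - 2) • p.EN N Λ₁ Λ₂) * p.Bᵀ * Λ₂)
  - (1 / (N : ℝ)) •
      ((Λ₁ * p.G + p.Gᵀ * Λ₁) + (1 - 1 / (N : ℝ)) • (Λ₂ * p.G + p.Gᵀ * Λ₂))
  - (1 / (N : ℝ)) • p.QΓ

/-- g₂. -/
noncomputable def g₂ (N : ℕ) (Λ₁ Λ₂ : Matrix (Fin n) (Fin n) ℝ) :
    Matrix (Fin n) (Fin n) ℝ :=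
  (Λ₁ + Λ₂) * p.B *
      ((N : ℝ) • p.EN N Λ₁ Λ₂ + (p.R1 Λ₁)⁻¹ - (p.R2 Λ₁ Λ₂)⁻¹) * p.Bᵀ * (Λ₁ + Λ₂)
  - (2 / (N : ℝ)) • (Λ₂ * p.B * (p.R1 Λ₁)⁻¹ * p.Bᵀ * Λ₂)
  + (1 / (N : ℝ) - 2) • (Λ₂ * p.B * p.EN N Λ₁ Λ₂ * p.Bᵀ * Λ₂)
  - Λ₁ * p.B * p.EN N Λ₁ Λ₂ * p.Bᵀ * Λ₂
  - Λ₂ * p.B * p.EN N Λ₁ Λ₂ * p.Bᵀ * Λ₁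
  + (1 / (N : ℝ)) • (Λ₂ * p.G + p.Gᵀ * Λ₂)

/-- Solution of the rescaled system (ODE-Λ^N) on [0,T]. -/
noncomputable def IsSolLamN (N : ℕ) (Λ₁ Λ₂ : ℝ → Matrix (Fin n) (Fin n) ℝ) : Prop :=
  (∀ t ∈ Icc (0 : ℝ) p.T, (Λ₁ t).IsSymm ∧ (Λ₂ t).IsSymm) ∧
  (∀ t ∈ Icc (0 : ℝ) p.T, (p.R1 (Λ₁ t)).PosDef ∧ (p.R2 (Λ₁ t) (Λ₂ t)).PosDef ∧
    (p.R2 (Λ₁ t) (Λ₂ t) - (1 / (N : ℝ)) • (p.B0ᵀ * Λ₂ t * p.B0)).PosDef) ∧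
  Λ₁ p.T = p.Qf + (1 / (N : ℝ)) • p.QfΓ ∧ Λ₂ p.T = p.QfΓ ∧
  (∀ t ∈ Icc (0 : ℝ) p.T, ∀ i j, HasDerivWithinAt (fun s => Λ₁ s i j)
    ((p.Ψ₁ (Λ₁ t) + p.g₁ N (Λ₁ t) (Λ₂ t)) i j) (Icc (0 : ℝ) p.T) t) ∧
  (∀ t ∈ Icc (0 : ℝ) p.T, ∀ i j, HasDerivWithinAt (fun s => Λ₂ s i j)
    ((p.Ψ₂ (Λ₁ t) (Λ₂ t) + p.g₂ N (Λ₁ t) (Λ₂ t)) i j) (Icc (0 : ℝ) p.T) t)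

/-! Companion (mean-field) equations. -/

/-- φ₁. -/
noncomputable def φ₁ (Λ₁ Λ₂ : Matrix (Fin n) (Fin n) ℝ) (S : Matrix (Fin n) (Fin 1) ℝ) :
    Matrix (Fin n) (Fin 1) ℝ :=
  (Λ₁ + Λ₂) * p.B * (p.R2 Λ₁ Λ₂)⁻¹ *
      (p.Bᵀ * S + p.B1ᵀ * Λ₁ * p.D + p.B0ᵀ * (Λ₁ + Λ₂) * p.D0)
    - (p.A + p.G)ᵀ * S

/-- φ₂. -/
noncomputable def φ₂ (Λ₁ Λ₂ : Matrix (Fin n) (Fin n) ℝ) (S : Matrix (Fin n) (Fin 1) ℝ) :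
    Matrix (Fin 1) (Fin 1) ℝ :=
  (Sᵀ * p.B + p.Dᵀ * Λ₁ * p.B1 + p.D0ᵀ * (Λ₁ + Λ₂) * p.B0) * (p.R2 Λ₁ Λ₂)⁻¹ *
      (p.Bᵀ * S + p.B1ᵀ * Λ₁ * p.D + p.B0ᵀ * (Λ₁ + Λ₂) * p.D0)
    - p.Dᵀ * Λ₁ * p.D - p.D0ᵀ * (Λ₁ + Λ₂) * p.D0

/-- Solution of the limiting companion system (ODE-Sr) on [0,T]. -/
noncomputable def IsSolSr (Λ₁ Λ₂ : ℝ → Matrix (Fin n) (Fin n) ℝ)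
    (S : ℝ → Matrix (Fin n) (Fin 1) ℝ) (r : ℝ → ℝ) : Prop :=
  S p.T = 0 ∧ r p.T = 0 ∧
  (∀ t ∈ Icc (0 : ℝ) p.T, ∀ i j, HasDerivWithinAt (fun s => S s i j)
    (p.φ₁ (Λ₁ t) (Λ₂ t) (S t) i j) (Icc (0 : ℝ) p.T) t) ∧
  (∀ t ∈ Icc (0 : ℝ) p.T, HasDerivWithinAt r
    ((p.φ₂ (Λ₁ t) (Λ₂ t) (S t)) 0 0) (Icc (0 : ℝ) p.T) t)

/-- g₀₁. -/
noncomputable def g01 (N : ℕ) (Λ₁ Λ₂ : Matrix (Fin n) (Fin n) ℝ)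
    (S : Matrix (Fin n) (Fin 1) ℝ) : Matrix (Fin n) (Fin 1) ℝ :=
  (Λ₁ + (1 - 1 / (N : ℝ)) • Λ₂) * p.B *
      (p.R2 Λ₁ Λ₂ - (1 / (N : ℝ)) • (p.B0ᵀ * Λ₂ * p.B0))⁻¹ *
      (p.Bᵀ * S + p.B1ᵀ * Λ₁ * p.D + p.B0ᵀ * (Λ₁ + (1 - 1 / (N : ℝ)) • Λ₂) * p.D0)
  - (Λ₁ + Λ₂) * p.B * (p.R2 Λ₁ Λ₂)⁻¹ *
      (p.Bᵀ * S + p.B1ᵀ * Λ₁ * p.D + p.B0ᵀ * (Λ₁ + Λ₂) * p.D0)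

/-- g₀₂. -/
noncomputable def g02 (N : ℕ) (Λ₁ Λ₂ : Matrix (Fin n) (Fin n) ℝ)
    (S : Matrix (Fin n) (Fin 1) ℝ) : Matrix (Fin 1) (Fin 1) ℝ :=
  (Sᵀ * p.B + p.Dᵀ * Λ₁ * p.B1 + p.D0ᵀ * (Λ₁ + (1 - 1 / (N : ℝ)) • Λ₂) * p.B0) *
      (p.R2 Λ₁ Λ₂ - (1 / (N : ℝ)) • (p.B0ᵀ * Λ₂ * p.B0))⁻¹ *
      (p.Bᵀ * S + p.B1ᵀ * Λ₁ * p.D + p.B0ᵀ * (Λ₁ + (1 - 1 / (N : ℝ)) • Λ₂) * p.D0)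
  - (Sᵀ * p.B + p.Dᵀ * Λ₁ * p.B1 + p.D0ᵀ * (Λ₁ + Λ₂) * p.B0) * (p.R2 Λ₁ Λ₂)⁻¹ *
      (p.Bᵀ * S + p.B1ᵀ * Λ₁ * p.D + p.B0ᵀ * (Λ₁ + Λ₂) * p.D0)
  + (1 / (N : ℝ)) • (p.D0ᵀ * Λ₂ * p.D0)

/-- Solution of the rescaled companion system (ODE-S^N r^N) on [0,T]. -/
noncomputable def IsSolSrN (N : ℕ) (Λ₁ Λ₂ : ℝ → Matrix (Fin n) (Fin n) ℝ)
    (S : ℝ → Matrix (Fin n) (Fin 1) ℝ) (r : ℝ → ℝ) : Prop :=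
  S p.T = 0 ∧ r p.T = 0 ∧
  (∀ t ∈ Icc (0 : ℝ) p.T, ∀ i j, HasDerivWithinAt (fun s => S s i j)
    ((p.φ₁ (Λ₁ t) (Λ₂ t) (S t) + p.g01 N (Λ₁ t) (Λ₂ t) (S t)) i j) (Icc (0 : ℝ) p.T) t) ∧
  (∀ t ∈ Icc (0 : ℝ) p.T, HasDerivWithinAt r
    ((p.φ₂ (Λ₁ t) (Λ₂ t) (S t) + p.g02 N (Λ₁ t) (Λ₂ t) (S t)) 0 0) (Icc (0 : ℝ) p.T) t)

/-! Feedback gains. -/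

/-- Θ = ℛ₁(Λ₁)⁻¹ Bᵀ Λ₁. -/
noncomputable def Theta (Λ₁ : Matrix (Fin n) (Fin n) ℝ) : Matrix (Fin n₁) (Fin n) ℝ :=
  (p.R1 Λ₁)⁻¹ * p.Bᵀ * Λ₁

/-- Θ₁ = (H₁ − H)Bᵀ(Λ₁+Λ₂) + HBᵀΛ₂. -/
noncomputable def Theta1 (Λ₁ Λ₂ : Matrix (Fin n) (Fin n) ℝ) : Matrix (Fin n₁) (Fin n) ℝ :=
  ((p.R2 Λ₁ Λ₂)⁻¹ - (p.R1 Λ₁)⁻¹) * p.Bᵀ * (Λ₁ + Λ₂) + (p.R1 Λ₁)⁻¹ * p.Bᵀ * Λ₂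

/-- Θ₂ = H₁[BᵀS + B₁ᵀΛ₁D + B₀ᵀ(Λ₁+Λ₂)D₀]. -/
noncomputable def Theta2 (Λ₁ Λ₂ : Matrix (Fin n) (Fin n) ℝ) (S : Matrix (Fin n) (Fin 1) ℝ) :
    Matrix (Fin n₁) (Fin 1) ℝ :=
  (p.R2 Λ₁ Λ₂)⁻¹ * (p.Bᵀ * S + p.B1ᵀ * Λ₁ * p.D + p.B0ᵀ * (Λ₁ + Λ₂) * p.D0)

/-- Θ^N. -/
noncomputable def ThetaN (N : ℕ) (Λ₁ Λ₂ : Matrix (Fin n) (Fin n) ℝ) :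
    Matrix (Fin n₁) (Fin n) ℝ :=
  (p.HN N Λ₁ Λ₂ - p.EN N Λ₁ Λ₂) * p.Bᵀ * (Λ₁ - (1 / (N : ℝ)) • Λ₂)

/-- Θ₁^N. -/
noncomputable def Theta1N (N : ℕ) (Λ₁ Λ₂ : Matrix (Fin n) (Fin n) ℝ) :
    Matrix (Fin n₁) (Fin n) ℝ :=
  (N : ℝ) • (p.EN N Λ₁ Λ₂ * p.Bᵀ * Λ₁)
    + (p.HN N Λ₁ Λ₂ + ((N : ℝ) - 2) • p.EN N Λ₁ Λ₂) * p.Bᵀ * Λ₂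

/-- Θ₂^N. -/
noncomputable def Theta2N (N : ℕ) (Λ₁ Λ₂ : Matrix (Fin n) (Fin n) ℝ)
    (S : Matrix (Fin n) (Fin 1) ℝ) : Matrix (Fin n₁) (Fin 1) ℝ :=
  (p.HN N Λ₁ Λ₂ + ((N : ℝ) - 1) • p.EN N Λ₁ Λ₂) *
    (p.Bᵀ * S + p.B1ᵀ * Λ₁ * p.D + p.B0ᵀ * (Λ₁ + (1 - 1 / (N : ℝ)) • Λ₂) * p.D0)

/-- Z₀ = −B₀(Θ + Θ₁). -/
noncomputable def Z0 (Λ₁ Λ₂ : Matrix (Fin n) (Fin n) ℝ) : Matrix (Fin n) (Fin n) ℝ :=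
  -(p.B0 * (p.Theta Λ₁ + p.Theta1 Λ₁ Λ₂))

/-- Z₁ = A + G − B(Θ + Θ₁). -/
noncomputable def Z1 (Λ₁ Λ₂ : Matrix (Fin n) (Fin n) ℝ) : Matrix (Fin n) (Fin n) ℝ :=
  p.A + p.G - p.B * (p.Theta Λ₁ + p.Theta1 Λ₁ Λ₂)

/-! The high-dimensional equations under the decentralized control. -/

/-- RHS of (ODE-P̌₁) (paper's −d𝐏̌₁/dt). -/
noncomputable def Pcheck1RHS (N : ℕ) (Θ : Matrix (Fin n₁) (Fin n) ℝ)
    (P1 : Matrix (Fin N × Fin n) (Fin N × Fin n) ℝ) :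
    Matrix (Fin N × Fin n) (Fin N × Fin n) ℝ :=
  (kronIN N Θ)ᵀ * (p.bigR N + p.M2 N ((2 : ℝ) • P1)) * kronIN N Θ
    + P1 * (p.bigA N - p.bigBhat N * kronIN N Θ)
    + (p.bigA N - p.bigBhat N * kronIN N Θ)ᵀ * P1
    + p.bigQ N

/-- Solution of (ODE-P̌₁) on [0,T], with Θ(t) built from Λ₁(t). -/
noncomputable def IsSolPcheck1 (N : ℕ) (Λ₁ : ℝ → Matrix (Fin n) (Fin n) ℝ)
    (P1 : ℝ → Matrix (Fin N × Fin n) (Fin N × Fin n) ℝ) : Prop :=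
  P1 p.T = p.bigQf N ∧
  (∀ t ∈ Icc (0 : ℝ) p.T, ∀ x y, HasDerivWithinAt (fun s => P1 s x y)
    ((-(p.Pcheck1RHS N (p.Theta (Λ₁ t)) (P1 t))) x y) (Icc (0 : ℝ) p.T) t)

/-- RHS of (ODE-P̌₁₂) (paper's −d𝐏̌₁₂/dt). -/
noncomputable def Pcheck12RHS (N : ℕ) (Λ₁m Λ₂m : Matrix (Fin n) (Fin n) ℝ)
    (P1 : Matrix (Fin N × Fin n) (Fin N × Fin n) ℝ)
    (P12 : Matrix (Fin N × Fin n) (Fin n) ℝ) :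
    Matrix (Fin N × Fin n) (Fin n) ℝ :=
  (kronIN N (p.Theta Λ₁m))ᵀ * (p.bigR N + p.M2 N ((2 : ℝ) • P1)) *
      stackN N (p.Theta1 Λ₁m Λ₂m)
    - P1 * p.bigBhat N * stackN N (p.Theta1 Λ₁m Λ₂m)
    + ((p.bigA N)ᵀ - (kronIN N (p.Theta Λ₁m))ᵀ * (p.bigBhat N)ᵀ) * P12
    + P12 * p.Z1 Λ₁m Λ₂m
    - (kronIN N (p.Theta Λ₁m))ᵀ * (p.bigIhat N)ᵀ * (p.bigB0 N)ᵀ * P12 * p.Z0 Λ₁m Λ₂m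

/-- Solution of (ODE-P̌₁₂) on [0,T]. -/
noncomputable def IsSolPcheck12 (N : ℕ) (Λ₁ Λ₂ : ℝ → Matrix (Fin n) (Fin n) ℝ)
    (P1 : ℝ → Matrix (Fin N × Fin n) (Fin N × Fin n) ℝ)
    (P12 : ℝ → Matrix (Fin N × Fin n) (Fin n) ℝ) : Prop :=
  P12 p.T = 0 ∧
  (∀ t ∈ Icc (0 : ℝ) p.T, ∀ x y, HasDerivWithinAt (fun s => P12 s x y)
    ((-(p.Pcheck12RHS N (Λ₁ t) (Λ₂ t) (P1 t) (P12 t))) x y) (Icc (0 : ℝ) p.T) t)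

/-! The decentralized-control low-dimensional coefficient system. -/

/-- ǧ₁. -/
noncomputable def gc1 (N : ℕ) (Θ : Matrix (Fin n₁) (Fin n) ℝ)
    (L1 L2 : Matrix (Fin n) (Fin n) ℝ) : Matrix (Fin n) (Fin n) ℝ :=
  (1 / (N : ℝ)) •
    (Θᵀ * p.B0ᵀ * (L1 + (1 - 1 / (N : ℝ)) • L2) * p.B0 * Θ
      + (L1 + (1 - 1 / (N : ℝ)) • L2) * p.G
      + p.Gᵀ * (L1 + (1 - 1 / (N : ℝ)) • L2)
      + p.QΓ)

/-- ǧ₂. -/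
noncomputable def gc2 (N : ℕ) (Θ : Matrix (Fin n₁) (Fin n) ℝ)
    (L2 : Matrix (Fin n) (Fin n) ℝ) : Matrix (Fin n) (Fin n) ℝ :=
  -((1 / (N : ℝ)) • (Θᵀ * p.B0ᵀ * L2 * p.B0 * Θ + L2 * p.G + p.Gᵀ * L2))

/-- ǧ₁₂. -/
noncomputable def gc12 (N : ℕ) (Θ Θ₁ : Matrix (Fin n₁) (Fin n) ℝ)
    (L2 : Matrix (Fin n) (Fin n) ℝ) : Matrix (Fin n) (Fin n) ℝ :=
  (1 / (N : ℝ)) • (-(Θᵀ * p.B0ᵀ * L2 * p.B0 * Θ₁) + L2 * p.B * Θ₁)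

/-- ǧ₂₂. -/
noncomputable def gc22 (N : ℕ) (Θ₁ : Matrix (Fin n₁) (Fin n) ℝ)
    (L2 : Matrix (Fin n) (Fin n) ℝ) : Matrix (Fin n) (Fin n) ℝ :=
  -((1 / (N : ℝ)) • (Θ₁ᵀ * p.B0ᵀ * L2 * p.B0 * Θ₁))

/-- ǧ₀₁. -/
noncomputable def gc01 (N : ℕ) (Θ : Matrix (Fin n₁) (Fin n) ℝ)
    (Θ₂ : Matrix (Fin n₁) (Fin 1) ℝ) (L2 : Matrix (Fin n) (Fin n) ℝ) :
    Matrix (Fin n) (Fin 1) ℝ :=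
  (1 / (N : ℝ)) • (Θᵀ * p.B0ᵀ * L2 * (p.D0 - p.B0 * Θ₂) + L2 * p.B * Θ₂)

/-- ǧ₀₂. -/
noncomputable def gc02 (N : ℕ) (Θ₁ : Matrix (Fin n₁) (Fin n) ℝ)
    (Θ₂ : Matrix (Fin n₁) (Fin 1) ℝ) (L2 : Matrix (Fin n) (Fin n) ℝ) :
    Matrix (Fin n) (Fin 1) ℝ :=
  (1 / (N : ℝ)) • (-(Θ₁ᵀ * p.B0ᵀ * L2 * p.B0 * Θ₂) + Θ₁ᵀ * p.B0ᵀ * L2 * p.D0)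

/-- RHS of (ODE-Λ̌₁^N) (paper's −dΛ̌₁^N/dt). -/
noncomputable def check1RHS (N : ℕ) (Θ : Matrix (Fin n₁) (Fin n) ℝ)
    (L1 L2 : Matrix (Fin n) (Fin n) ℝ) : Matrix (Fin n) (Fin n) ℝ :=
  Θᵀ * p.R1 L1 * Θ + L1 * (p.A - p.B * Θ) + (p.A - p.B * Θ)ᵀ * L1 + p.Q
    + p.gc1 N Θ L1 L2

/-- RHS of (ODE-Λ̌₂^N). -/
noncomputable def check2RHS (N : ℕ) (Θ : Matrix (Fin n₁) (Fin n) ℝ)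
    (L1 L2 : Matrix (Fin n) (Fin n) ℝ) : Matrix (Fin n) (Fin n) ℝ :=
  Θᵀ * p.B0ᵀ * (L1 + L2) * p.B0 * Θ + L1 * p.G + p.Gᵀ * L1
    + L2 * (p.A + p.G - p.B * Θ) + (p.A + p.G - p.B * Θ)ᵀ * L2 + p.QΓ
    + p.gc2 N Θ L2

/-- RHS of (ODE-Λ̌₁₂^N). -/
noncomputable def check12RHS (N : ℕ) (Θ Θ₁ : Matrix (Fin n₁) (Fin n) ℝ)
    (L1 L2 L12 : Matrix (Fin n) (Fin n) ℝ) : Matrix (Fin n) (Fin n) ℝ :=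
  Θᵀ * p.R2 L1 L2 * Θ₁ + Θᵀ * p.B0ᵀ * L12 * p.B0 * (Θ + Θ₁)
    - (L1 + L2) * p.B * Θ₁
    + (p.A + p.G - p.B * Θ)ᵀ * L12
    + L12 * (p.A + p.G - p.B * (Θ₁ + Θ))
    + p.gc12 N Θ Θ₁ L2

/-- RHS of (ODE-Λ̌₂₂^N). -/
noncomputable def check22RHS (N : ℕ) (Θ₁ : Matrix (Fin n₁) (Fin n) ℝ)
    (Z₀ Z₁ : Matrix (Fin n) (Fin n) ℝ)
    (L1 L2 L12 L22 : Matrix (Fin n) (Fin n) ℝ) : Matrix (Fin n) (Fin n) ℝ :=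
  Θ₁ᵀ * p.R2 L1 L2 * Θ₁ - L12ᵀ * p.B * Θ₁ - Θ₁ᵀ * p.Bᵀ * L12
    + L22 * Z₁ + Z₁ᵀ * L22
    - Z₀ᵀ * L12ᵀ * p.B0 * Θ₁ - Θ₁ᵀ * p.B0ᵀ * L12 * Z₀
    + Z₀ᵀ * L22 * Z₀ + p.gc22 N Θ₁ L2

/-- RHS of (ODE-Š₁^N). -/
noncomputable def checkS1RHS (N : ℕ) (Θ : Matrix (Fin n₁) (Fin n) ℝ)
    (Θ₂ : Matrix (Fin n₁) (Fin 1) ℝ) (L1 L2 L12 : Matrix (Fin n) (Fin n) ℝ)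
    (S1 : Matrix (Fin n) (Fin 1) ℝ) : Matrix (Fin n) (Fin 1) ℝ :=
  Θᵀ * p.R2 L1 L2 * Θ₂ - (L1 + L2 + L12) * p.B * Θ₂
    - Θᵀ * (p.Bᵀ * S1 + p.B1ᵀ * L1 * p.D + p.B0ᵀ * (L1 + L2) * p.D0)
    - Θᵀ * p.B0ᵀ * L12 * (p.D0 - p.B0 * Θ₂)
    + (p.A + p.G)ᵀ * S1
    + p.gc01 N Θ Θ₂ L2

/-- RHS of (ODE-Š₂^N). -/
noncomputable def checkS2RHS (N : ℕ) (Θ₁ : Matrix (Fin n₁) (Fin n) ℝ)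
    (Θ₂ : Matrix (Fin n₁) (Fin 1) ℝ) (Z₀ Z₁ : Matrix (Fin n) (Fin n) ℝ)
    (L1 L2 L12 L22 : Matrix (Fin n) (Fin n) ℝ)
    (S1 S2 : Matrix (Fin n) (Fin 1) ℝ) : Matrix (Fin n) (Fin 1) ℝ :=
  Θ₁ᵀ * p.R2 L1 L2 * Θ₂ + Z₁ᵀ * S2
    - Θ₁ᵀ * (p.Bᵀ * S1 + p.B1ᵀ * L1 * p.D + p.B0ᵀ * (L1 + L2) * p.D0)
    + (Z₀ᵀ * L22 + Z₀ᵀ * L12ᵀ - Θ₁ᵀ * p.B0ᵀ * L12) * (p.D0 - p.B0 * Θ₂)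
    - (L12ᵀ + L22) * p.B * Θ₂
    + p.gc02 N Θ₁ Θ₂ L2

/-- Solution of the pair (ODE-Λ̌₁^N)–(ODE-Λ̌₂^N) on [0,T], with Θ(t) from the limiting Λ₁. -/
noncomputable def IsSolCheckA (N : ℕ) (Λ₁ : ℝ → Matrix (Fin n) (Fin n) ℝ)
    (L1 L2 : ℝ → Matrix (Fin n) (Fin n) ℝ) : Prop :=
  L1 p.T = p.Qf + (1 / (N : ℝ)) • p.QfΓ ∧ L2 p.T = p.QfΓ ∧
  (∀ t ∈ Icc (0 : ℝ) p.T, ∀ i j, HasDerivWithinAt (fun s => L1 s i j)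
    ((-(p.check1RHS N (p.Theta (Λ₁ t)) (L1 t) (L2 t))) i j) (Icc (0 : ℝ) p.T) t) ∧
  (∀ t ∈ Icc (0 : ℝ) p.T, ∀ i j, HasDerivWithinAt (fun s => L2 s i j)
    ((-(p.check2RHS N (p.Theta (Λ₁ t)) (L1 t) (L2 t))) i j) (Icc (0 : ℝ) p.T) t)

/-- Solution of (ODE-Λ̌₁^N)–(ODE-Λ̌₂₂^N) on [0,T], with Θ, Θ₁, Z₀, Z₁ from the limiting (Λ₁, Λ₂). -/
noncomputable def IsSolCheckB (N : ℕ) (Λ₁ Λ₂ : ℝ → Matrix (Fin n) (Fin n) ℝ)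
    (L1 L2 L12 L22 : ℝ → Matrix (Fin n) (Fin n) ℝ) : Prop :=
  p.IsSolCheckA N Λ₁ L1 L2 ∧
  L12 p.T = 0 ∧ L22 p.T = 0 ∧
  (∀ t ∈ Icc (0 : ℝ) p.T, ∀ i j, HasDerivWithinAt (fun s => L12 s i j)
    ((-(p.check12RHS N (p.Theta (Λ₁ t)) (p.Theta1 (Λ₁ t) (Λ₂ t))
        (L1 t) (L2 t) (L12 t))) i j) (Icc (0 : ℝ) p.T) t) ∧
  (∀ t ∈ Icc (0 : ℝ) p.T, ∀ i j, HasDerivWithinAt (fun s => L22 s i j)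
    ((-(p.check22RHS N (p.Theta1 (Λ₁ t) (Λ₂ t)) (p.Z0 (Λ₁ t) (Λ₂ t))
        (p.Z1 (Λ₁ t) (Λ₂ t)) (L1 t) (L2 t) (L12 t) (L22 t))) i j) (Icc (0 : ℝ) p.T) t)

/-- Solution of the full decentralized coefficient system on [0,T],
with Θ, Θ₁, Θ₂, Z₀, Z₁ from the limiting (Λ₁, Λ₂, S). -/
noncomputable def IsSolCheckC (N : ℕ) (Λ₁ Λ₂ : ℝ → Matrix (Fin n) (Fin n) ℝ)
    (S : ℝ → Matrix (Fin n) (Fin 1) ℝ)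
    (L1 L2 L12 L22 : ℝ → Matrix (Fin n) (Fin n) ℝ)
    (S1 S2 : ℝ → Matrix (Fin n) (Fin 1) ℝ) : Prop :=
  p.IsSolCheckB N Λ₁ Λ₂ L1 L2 L12 L22 ∧
  S1 p.T = 0 ∧ S2 p.T = 0 ∧
  (∀ t ∈ Icc (0 : ℝ) p.T, ∀ i j, HasDerivWithinAt (fun s => S1 s i j)
    ((-(p.checkS1RHS N (p.Theta (Λ₁ t)) (p.Theta2 (Λ₁ t) (Λ₂ t) (S t))
        (L1 t) (L2 t) (L12 t) (S1 t))) i j) (Icc (0 : ℝ) p.T) t) ∧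
  (∀ t ∈ Icc (0 : ℝ) p.T, ∀ i j, HasDerivWithinAt (fun s => S2 s i j)
    ((-(p.checkS2RHS N (p.Theta1 (Λ₁ t) (Λ₂ t)) (p.Theta2 (Λ₁ t) (Λ₂ t) (S t))
        (p.Z0 (Λ₁ t) (Λ₂ t)) (p.Z1 (Λ₁ t) (Λ₂ t))
        (L1 t) (L2 t) (L12 t) (L22 t) (S1 t) (S2 t))) i j) (Icc (0 : ℝ) p.T) t)

end Params

open scoped Kronecker

/-- The `N × N` averaging matrix, all of whose entries are `1 / N`. -/
noncomputable def avg (N : ℕ) : Matrix (Fin N) (Fin N) ℝ := Matrix.of fun _ _ => 1 / (N : ℝ)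

/-- The block matrix acting as `Z` on the mean component and as `X` on its complement. -/
noncomputable def meanSplit (N : ℕ) {a b : ℕ} (X Z : Matrix (Fin a) (Fin b) ℝ) :
    Matrix (Fin N × Fin a) (Fin N × Fin b) ℝ :=
  (1 - avg N) ⊗ₖ X + avg N ⊗ₖ Z

lemma avg_mul_avg {N : ℕ} (hN : N ≠ 0) : avg N * avg N = avg N := by
  have h : (N : ℝ) ≠ 0 := by exact_mod_cast hN
  ext i j
  simp [avg, Matrix.mul_apply]
  field_simp

lemma meanSplit_apply (N : ℕ) {a b : ℕ} (X Z : Matrix (Fin a) (Fin b) ℝ)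
    (x : Fin N × Fin a) (y : Fin N × Fin b) :
    meanSplit N X Z x y =
      (if x.1 = y.1 then X x.2 y.2 else 0) + (Z x.2 y.2 - X x.2 y.2) / (N : ℝ) := by
  simp only [meanSplit, avg, Matrix.add_apply, Matrix.kroneckerMap_apply, Matrix.sub_apply,
    Matrix.one_apply, Matrix.of_apply]
  split_ifs <;> ring

lemma meanSplit_mul {N : ℕ} (hN : N ≠ 0) {a b c : ℕ} (X Z : Matrix (Fin a) (Fin b) ℝ)
    (X' Z' : Matrix (Fin b) (Fin c) ℝ) :
    meanSplit N X Z * meanSplit N X' Z' = meanSplit N (X * X') (Z * Z') := by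
  have h := avg_mul_avg hN
  simp only [meanSplit, Matrix.add_mul, Matrix.mul_add, ← Matrix.mul_kronecker_mul,
    Matrix.sub_mul, Matrix.mul_sub, h, Matrix.one_mul, Matrix.mul_one, sub_self,
    Matrix.zero_kronecker, sub_zero, add_zero, zero_add]

lemma meanSplit_transpose (N : ℕ) {a b : ℕ} (X Z : Matrix (Fin a) (Fin b) ℝ) :
    (meanSplit N X Z)ᵀ = meanSplit N Xᵀ Zᵀ := by
  ext x y
  simp only [Matrix.transpose_apply, meanSplit_apply, eq_comm]

lemma meanSplit_sub (N : ℕ) {a b : ℕ} (X Z X' Z' : Matrix (Fin a) (Fin b) ℝ) :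
    meanSplit N X Z - meanSplit N X' Z' = meanSplit N (X - X') (Z - Z') := by
  ext x y
  simp only [Matrix.sub_apply, meanSplit_apply]
  split_ifs <;> ring

lemma meanSplit_add (N : ℕ) {a b : ℕ} (X Z X' Z' : Matrix (Fin a) (Fin b) ℝ) :
    meanSplit N X Z + meanSplit N X' Z' = meanSplit N (X + X') (Z + Z') := by
  ext x y
  simp only [Matrix.add_apply, meanSplit_apply]
  split_ifs <;> ring

lemma meanSplit_smul (N : ℕ) {a b : ℕ} (c : ℝ) (X Z : Matrix (Fin a) (Fin b) ℝ) :
    c • meanSplit N X Z = meanSplit N (c • X) (c • Z) := by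
  ext x y
  simp only [Matrix.smul_apply, meanSplit_apply, smul_eq_mul]
  split_ifs <;> ring

lemma meanSplit_one (N a : ℕ) :
    meanSplit N (1 : Matrix (Fin a) (Fin a) ℝ) 1 = 1 := by
  rw [meanSplit, ← Matrix.add_kronecker, sub_add_cancel, Matrix.one_kronecker_one]

lemma meanSplit_inv {N : ℕ} (hN : N ≠ 0) {a : ℕ} {X Z : Matrix (Fin a) (Fin a) ℝ}
    (hX : IsUnit X.det) (hZ : IsUnit Z.det) :
    (meanSplit N X Z)⁻¹ = meanSplit N X⁻¹ Z⁻¹ := by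
  apply Matrix.inv_eq_right_inv
  rw [meanSplit_mul hN, Matrix.mul_nonsing_inv _ hX, Matrix.mul_nonsing_inv _ hZ, meanSplit_one]

open scoped ComplexOrder MatrixOrder in
lemma meanSplit_posSemidef {N : ℕ} (hN : N ≠ 0) {a : ℕ} {X Z : Matrix (Fin a) (Fin a) ℝ}
    (hX : X.PosSemidef) (hZ : Z.PosSemidef) : (meanSplit N X Z).PosSemidef := by
  obtain ⟨C, rfl⟩ := CStarAlgebra.nonneg_iff_eq_star_mul_self.mp hX.nonneg
  obtain ⟨D, rfl⟩ := CStarAlgebra.nonneg_iff_eq_star_mul_self.mp hZ.nonneg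
  have h := Matrix.posSemidef_conjTranspose_mul_self (meanSplit N C D)
  simpa only [Matrix.conjTranspose_eq_transpose_of_trivial, meanSplit_transpose,
    meanSplit_mul hN, Matrix.star_eq_conjTranspose] using h

lemma blockPN_eq_meanSplit (N n : ℕ) (L₁ L₂ : Matrix (Fin n) (Fin n) ℝ) :
    blockPN N n L₁ L₂ =
      meanSplit N (L₁ - (1 / (N : ℝ)) • L₂) (L₁ + (1 - 1 / (N : ℝ)) • L₂) := by
  ext x y
  simp only [meanSplit_apply, blockPN, Matrix.of_apply, Matrix.sub_apply, Matrix.add_apply,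
    Matrix.smul_apply, smul_eq_mul]
  split_ifs <;> ring

namespace Params

variable {n n₁ : ℕ} (p : Params n n₁)

lemma bigA_eq (N : ℕ) : p.bigA N = meanSplit N p.A (p.A + p.G) := by
  ext x y
  simp [meanSplit_apply, bigA]

lemma bigQ_eq (N : ℕ) : p.bigQ N = meanSplit N p.Q (p.Q + p.QΓ) := by
  ext x y
  simp [meanSplit_apply, bigQ]

lemma bigBhat_eq (N : ℕ) : p.bigBhat N = meanSplit N p.B p.B := by
  ext x y
  simp [meanSplit_apply, bigBhat]

lemma bigR_eq (N : ℕ) : p.bigR N = meanSplit N p.R p.R := by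
  ext x y
  simp [meanSplit_apply, bigR]

lemma bigB_mul_bigE (N : ℕ) (i : Fin N) :
    p.bigB N i * p.bigE N i = Matrix.single i i (1 : ℝ) ⊗ₖ p.B1 := by
  ext x y
  simp only [Matrix.mul_apply, bigB, bigE, Matrix.of_apply, Matrix.kroneckerMap_apply,
    Matrix.single_apply]
  simp only [eq_comm (a := i) (b := x.1), eq_comm (a := i) (b := y.1)]
  by_cases hx : x.1 = i <;> by_cases hy : y.1 = i <;> simp [hx, hy]

lemma bigB0_mul_bigIhat (N : ℕ) :
    p.bigB0 N * p.bigIhat N = meanSplit N 0 p.B0 := by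
  ext x y
  simp [Matrix.mul_apply, bigB0, bigIhat, meanSplit_apply]

/-- The localized control-noise term only sees the diagonal blocks. -/
lemma sum_bigB_quadratic (N : ℕ) (L₁ L₂ : Matrix (Fin n) (Fin n) ℝ) :
    ∑ i : Fin N, (p.bigE N i)ᵀ * (p.bigB N i)ᵀ * blockPN N n L₁ L₂ * p.bigB N i * p.bigE N i
      = meanSplit N (p.B1ᵀ * L₁ * p.B1) (p.B1ᵀ * L₁ * p.B1) := by
  have hP : blockPN N n L₁ L₂ =
      (1 : Matrix (Fin N) (Fin N) ℝ) ⊗ₖ (L₁ - (1 / (N : ℝ)) • L₂) + avg N ⊗ₖ L₂ := by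
    ext x y
    simp only [blockPN, avg, Matrix.of_apply, Matrix.add_apply, Matrix.kroneckerMap_apply,
      Matrix.one_apply, Matrix.sub_apply, Matrix.smul_apply, smul_eq_mul]
    split_ifs <;> ring
  have hterm : ∀ i : Fin N,
      (p.bigE N i)ᵀ * (p.bigB N i)ᵀ * blockPN N n L₁ L₂ * p.bigB N i * p.bigE N i
        = Matrix.single i i (1 : ℝ) ⊗ₖ (p.B1ᵀ * L₁ * p.B1) := by
    intro i
    have havg : Matrix.single i i (1 : ℝ) * avg N * Matrix.single i i (1 : ℝ)
        = (1 / (N : ℝ)) • Matrix.single i i (1 : ℝ) := by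
      rw [Matrix.single_mul_mul_single]
      simp [avg]
    rw [← Matrix.transpose_mul, Matrix.mul_assoc, bigB_mul_bigE, hP,
      ← Matrix.kroneckerMap_transpose, Matrix.transpose_single, Matrix.mul_add, Matrix.add_mul,
      ← Matrix.mul_kronecker_mul, ← Matrix.mul_kronecker_mul, ← Matrix.mul_kronecker_mul,
      ← Matrix.mul_kronecker_mul, havg, Matrix.mul_one, Matrix.single_mul_single_same]
    simp only [mul_one, Matrix.smul_kronecker, ← Matrix.kronecker_smul, ← Matrix.kronecker_add,
      Matrix.mul_sub, Matrix.sub_mul, Matrix.mul_smul, Matrix.smul_mul, sub_add_cancel]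
  simp only [hterm]
  ext x y
  rw [Matrix.sum_apply]
  simp only [meanSplit_apply, Matrix.kroneckerMap_apply, Matrix.single_apply, sub_self, zero_div,
    add_zero]
  by_cases hxy : x.1 = y.1
  · simp [hxy]
  · rw [if_neg hxy]
    refine Finset.sum_eq_zero fun i _ => ?_
    rw [if_neg (by rintro ⟨rfl, h⟩; exact hxy h), zero_mul]

lemma R2_sub_eq (N : ℕ) (L₁ L₂ : Matrix (Fin n) (Fin n) ℝ) :
    p.R2 L₁ L₂ - (1 / (N : ℝ)) • (p.B0ᵀ * L₂ * p.B0) =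
      p.R1 L₁ + p.B0ᵀ * (L₁ + (1 - 1 / (N : ℝ)) • L₂) * p.B0 := by
  simp only [R1, R2, Matrix.mul_add, Matrix.add_mul, Matrix.mul_smul, Matrix.smul_mul]
  module

lemma bigR_add_M2_blockPN {N : ℕ} (hN : N ≠ 0) (L₁ L₂ : Matrix (Fin n) (Fin n) ℝ) :
    p.bigR N + (2 : ℝ) • p.M2 N (blockPN N n L₁ L₂) =
      meanSplit N (p.R1 L₁) (p.R2 L₁ L₂ - (1 / (N : ℝ)) • (p.B0ᵀ * L₂ * p.B0)) := by
  have h0 : (p.bigIhat N)ᵀ * (p.bigB0 N)ᵀ * blockPN N n L₁ L₂ * p.bigB0 N * p.bigIhat N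
      = meanSplit N 0 (p.B0ᵀ * (L₁ + (1 - 1 / (N : ℝ)) • L₂) * p.B0) := by
    rw [← Matrix.transpose_mul, Matrix.mul_assoc, bigB0_mul_bigIhat, blockPN_eq_meanSplit,
      meanSplit_transpose, meanSplit_mul hN, meanSplit_mul hN, Matrix.mul_zero]
  rw [M2, sum_bigB_quadratic, h0, bigR_eq, smul_add, smul_smul, smul_smul]
  norm_num only [one_smul, mul_one_div_cancel]
  rw [meanSplit_add, meanSplit_add, add_zero, R2_sub_eq, R1]
  simp only [add_assoc]

lemma PRic_blockPN {N : ℕ} (hN : N ≠ 0) (L₁ L₂ : Matrix (Fin n) (Fin n) ℝ)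
    (h₁ : IsUnit (p.R1 L₁).det)
    (h₂ : IsUnit (p.R2 L₁ L₂ - (1 / (N : ℝ)) • (p.B0ᵀ * L₂ * p.B0)).det) :
    p.PRic N (blockPN N n L₁ L₂) =
      blockPN N n (p.Ψ₁ L₁ + p.g₁ N L₁ L₂) (p.Ψ₂ L₁ L₂ + p.g₂ N L₁ L₂) := by
  have hN' : (N : ℝ) ≠ 0 := by exact_mod_cast hN
  rw [PRic, bigR_add_M2_blockPN p hN, meanSplit_inv hN h₁ h₂, bigA_eq, bigQ_eq, bigBhat_eq]
  simp only [blockPN_eq_meanSplit, meanSplit_transpose, meanSplit_mul hN, meanSplit_sub]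
  simp only [Ψ₁, Ψ₂, g₁, g₂, HN, EN]
  generalize (p.R2 L₁ L₂ - (1 / (N : ℝ)) • (p.B0ᵀ * L₂ * p.B0))⁻¹ = V
  generalize (p.R1 L₁)⁻¹ = U
  generalize (p.R2 L₁ L₂)⁻¹ = W
  congr 1
  · simp only [Matrix.mul_add, Matrix.add_mul, Matrix.mul_sub, Matrix.sub_mul, Matrix.mul_smul,
      Matrix.smul_mul, Matrix.mul_assoc]
    match_scalars <;> field_simp <;> ring
  · simp only [Matrix.mul_add, Matrix.add_mul, Matrix.mul_sub, Matrix.sub_mul, Matrix.mul_smul,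
      Matrix.smul_mul, Matrix.transpose_add, Matrix.mul_assoc]
    match_scalars <;> field_simp <;> ring

end Params

lemma abs_apply_le_frob {a b : Type*} [Fintype a] [Fintype b] (M : Matrix a b ℝ) (i : a) (j : b) :
    |M i j| ≤ frob M := by
  rw [frob, ← Real.sqrt_sq_eq_abs]
  apply Real.sqrt_le_sqrt
  calc (M i j) ^ 2 ≤ ∑ j, (M i j) ^ 2 :=
        Finset.single_le_sum (f := fun j => (M i j) ^ 2) (fun _ _ => sq_nonneg _)
          (Finset.mem_univ j)
    _ ≤ _ := Finset.single_le_sum (f := fun i => ∑ j, (M i j) ^ 2)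
          (fun _ _ => Finset.sum_nonneg fun _ _ => sq_nonneg _) (Finset.mem_univ i)

lemma frob_nonneg {a b : Type*} [Fintype a] [Fintype b] (M : Matrix a b ℝ) : 0 ≤ frob M :=
  Real.sqrt_nonneg _

lemma l1norm_blockPN_div_le {N : ℕ} (hN : N ≠ 0) {n : ℕ} {L₁ L₂ : Matrix (Fin n) (Fin n) ℝ}
    {C : ℝ} (h : frob L₁ + frob L₂ ≤ C) :
    l1norm (blockPN N n L₁ L₂) / (N : ℝ) ≤ (n : ℝ) ^ 2 * C := by
  have hN' : (0 : ℝ) < N := by exact_mod_cast Nat.pos_of_ne_zero hN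
  have hentry : ∀ x y, |blockPN N n L₁ L₂ x y| ≤
      (if x.1 = y.1 then frob L₁ else 0) + frob L₂ / N := by
    intro x y
    have h₂ : 0 ≤ frob L₂ / N := div_nonneg (frob_nonneg _) hN'.le
    simp only [blockPN, Matrix.of_apply]
    split_ifs
    · linarith [abs_apply_le_frob L₁ x.2 y.2]
    · rw [abs_div, abs_of_pos hN', zero_add]
      exact div_le_div_of_nonneg_right (abs_apply_le_frob L₂ x.2 y.2) hN'.le
  have hsum : l1norm (blockPN N n L₁ L₂) ≤ N * (n ^ 2 * (frob L₁ + frob L₂)) := by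
    refine (Finset.sum_le_sum fun x _ => Finset.sum_le_sum fun y _ => hentry x y).trans_eq ?_
    have hdiag : ∀ x : Fin N × Fin n,
        ∑ y : Fin N × Fin n, (if x.1 = y.1 then frob L₁ else 0) = n * frob L₁ := by
      intro x
      rw [Fintype.sum_prod_type_right]
      simp
    simp only [Finset.sum_add_distrib, hdiag]
    simp
    field_simp
  rw [div_le_iff₀ hN', mul_comm _ (N : ℝ)]
  refine hsum.trans ?_
  gcongr

lemma dotProduct_mulVec_le {ι : Type*} [Fintype ι] (M : Matrix ι ι ℝ) {m : ℝ}
    (hM : ∀ i j, |M i j| ≤ m) (v : ι → ℝ) :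
    v ⬝ᵥ (M *ᵥ v) ≤ m * Fintype.card ι * (v ⬝ᵥ v) := by
  have hterm : ∀ i j, v i * (M i j * v j) ≤ m * ((v i ^ 2 + v j ^ 2) / 2) := by
    intro i j
    have h₁ : v i * (M i j * v j) ≤ |M i j| * (|v i| * |v j|) := by
      calc v i * (M i j * v j) ≤ |v i * (M i j * v j)| := le_abs_self _
        _ = _ := by rw [abs_mul, abs_mul]; ring
    have h₂ : |v i| * |v j| ≤ (v i ^ 2 + v j ^ 2) / 2 := by
      nlinarith [sq_nonneg (|v i| - |v j|), sq_abs (v i), sq_abs (v j)]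
    exact h₁.trans (mul_le_mul (hM i j) h₂ (by positivity) ((abs_nonneg _).trans (hM i j)))
  calc v ⬝ᵥ (M *ᵥ v) = ∑ i, ∑ j, v i * (M i j * v j) := by
        simp only [dotProduct, Matrix.mulVec, Finset.mul_sum]
    _ ≤ ∑ i, ∑ j, m * ((v i ^ 2 + v j ^ 2) / 2) :=
        Finset.sum_le_sum fun i _ => Finset.sum_le_sum fun j _ => hterm i j
    _ = m * Fintype.card ι * (v ⬝ᵥ v) := by
        simp only [← Finset.mul_sum, ← Finset.sum_div, Finset.sum_add_distrib, dotProduct,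
          Finset.sum_const, Finset.card_univ, nsmul_eq_mul, ← pow_two]
        ring

/-- The entries of `Bᵀ L B` are controlled by the Frobenius norm of `L`. -/
lemma abs_transpose_mul_mul_apply_le {a b : Type*} [Fintype a] (B : Matrix a b ℝ)
    (L : Matrix a a ℝ) {C : ℝ} (hL : frob L ≤ C) (i j : b) :
    |(Bᵀ * L * B) i j| ≤ C * ((∑ l, |B l i|) * ∑ k, |B k j|) := by
  have hC : ∀ l k, |L l k| ≤ C := fun l k => (abs_apply_le_frob L l k).trans hL
  calc |(Bᵀ * L * B) i j| ≤ ∑ k, ∑ l, |B l i| * |L l k| * |B k j| := by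
        simp only [Matrix.mul_apply, Matrix.transpose_apply, Finset.sum_mul]
        refine (Finset.abs_sum_le_sum_abs _ _).trans (Finset.sum_le_sum fun k _ => ?_)
        refine (Finset.abs_sum_le_sum_abs _ _).trans (Finset.sum_le_sum fun l _ => ?_)
        rw [abs_mul, abs_mul]
    _ ≤ ∑ k, ∑ l, |B l i| * C * |B k j| := by
        gcongr with k _ l _
        exact hC l k
    _ = C * ((∑ l, |B l i|) * ∑ k, |B k j|) := by
        rw [Finset.sum_mul_sum, Finset.sum_comm, Finset.mul_sum]
        refine Finset.sum_congr rfl fun l _ => ?_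
        rw [Finset.mul_sum]
        exact Finset.sum_congr rfl fun k _ => by ring

/-- A small symmetric perturbation with bounded entries at most halves a coercivity constant. -/
lemma posSemidef_sub_smul_sub {ι : Type*} [Fintype ι] [DecidableEq ι] {S M : Matrix ι ι ℝ}
    {c m ε : ℝ} (hS : (S - c • 1).PosSemidef) (hMs : M.IsSymm) (hM : ∀ i j, |M i j| ≤ m)
    (hε : 0 ≤ ε) (hsmall : ε * (m * Fintype.card ι) ≤ c / 2) :
    (S - ε • M - (c / 2) • 1).PosSemidef := by
  have hMh : M.IsHermitian := by
    rw [Matrix.IsHermitian, Matrix.conjTranspose_eq_transpose_of_trivial]; exact hMs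
  have hherm : ((c / 2) • (1 : Matrix ι ι ℝ) - ε • M).IsHermitian := by
    rw [Matrix.IsHermitian]
    simp [hMs.eq]
  have h : ((c / 2) • (1 : Matrix ι ι ℝ) - ε • M).PosSemidef := by
    refine Matrix.PosSemidef.of_dotProduct_mulVec_nonneg hherm fun v => ?_
    have h₁ := mul_le_mul_of_nonneg_left (dotProduct_mulVec_le M hM v) hε
    have h₂ : 0 ≤ v ⬝ᵥ v := Finset.sum_nonneg fun i _ => mul_self_nonneg _
    have h₃ := mul_le_mul_of_nonneg_right hsmall h₂
    simp only [star_trivial, Matrix.sub_mulVec, Matrix.smul_mulVec, Matrix.one_mulVec,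
      dotProduct_sub, dotProduct_smul, smul_eq_mul]
    linarith
  have heq : S - ε • M - (c / 2) • 1 = (S - c • 1) + ((c / 2) • 1 - ε • M) := by module
  rw [heq]
  exact hS.add h

/-- a uniformly bounded family of solutions of (ODE-Λ^N) with ℛ₁, ℛ₂ ≥ c₁ I
yields asymptotic solvability. -/
theorem solLamN_family_implies_asympSolvable {n n₁ : ℕ} (p : Params n n₁) (hp : p.Standing)
    (N₁ : ℕ) (hN₁ : 1 ≤ N₁) (c₁ Cb : ℝ) (hc₁ : 0 < c₁)
    (Λ₁ Λ₂ : (N : ℕ) → ℝ → Matrix (Fin n) (Fin n) ℝ)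
    (hsol : ∀ N : ℕ, N₁ ≤ N → p.IsSolLamN N (Λ₁ N) (Λ₂ N))
    (hbd : ∀ N : ℕ, N₁ ≤ N → ∀ t ∈ Icc (0 : ℝ) p.T,
      frob (Λ₁ N t) + frob (Λ₂ N t) ≤ Cb)
    (hR : ∀ N : ℕ, N₁ ≤ N → ∀ t ∈ Icc (0 : ℝ) p.T,
      (p.R1 (Λ₁ N t) - c₁ • 1).PosSemidef ∧
      (p.R2 (Λ₁ N t) (Λ₂ N t) - c₁ • 1).PosSemidef) :
    p.AsympSolvable := by
  have hTmem : (0 : ℝ) ∈ Icc (0 : ℝ) p.T := ⟨le_rfl, hp.2.2.1.le⟩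
  have hCb : 0 ≤ Cb := (add_nonneg (frob_nonneg _) (frob_nonneg _)).trans
    (hbd N₁ le_rfl 0 hTmem)
  -- a bound on the entries of `B₀ᵀ Λ₂ B₀`, uniform in `N` and `t`
  set m : ℝ := Cb * ((∑ i, ∑ l, |p.B0 l i|) * ∑ i, ∑ l, |p.B0 l i|) with hm
  have hcol : ∀ i, ∑ l, |p.B0 l i| ≤ ∑ i, ∑ l, |p.B0 l i| := fun i =>
    Finset.single_le_sum (f := fun i => ∑ l, |p.B0 l i|)
      (fun _ _ => Finset.sum_nonneg fun _ _ => abs_nonneg _) (Finset.mem_univ i)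
  have hentry : ∀ N, N₁ ≤ N → ∀ t ∈ Icc (0 : ℝ) p.T, ∀ i j,
      |(p.B0ᵀ * Λ₂ N t * p.B0) i j| ≤ m := by
    intro N hN t ht i j
    have hle : frob (Λ₂ N t) ≤ Cb := by
      linarith [hbd N hN t ht, frob_nonneg (Λ₁ N t)]
    refine (abs_transpose_mul_mul_apply_le p.B0 _ hle i j).trans ?_
    rw [hm]
    gcongr
    · exact hcol i
    · exact hcol j
  obtain ⟨N₂, hN₂⟩ := exists_nat_ge (m * n₁ / (c₁ / 2))
  refine ⟨max N₁ N₂, le_max_of_le_left hN₁, c₁ / 2, half_pos hc₁, (n : ℝ) ^ 2 * Cb,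
    fun N hN => ?_⟩
  have hNN₁ : N₁ ≤ N := (le_max_left _ _).trans hN
  have hN0 : N ≠ 0 := by omega
  have hNpos : (0 : ℝ) < N := by exact_mod_cast Nat.pos_of_ne_zero hN0
  have hsmall : 1 / (N : ℝ) * (m * Fintype.card (Fin n₁)) ≤ c₁ / 2 := by
    have hN₂N : (N₂ : ℝ) ≤ N := by exact_mod_cast (le_max_right _ _).trans hN
    have h := hN₂.trans hN₂N
    rw [div_le_iff₀ (half_pos hc₁)] at h
    rw [Fintype.card_fin, one_div_mul_eq_div, div_le_iff₀ hNpos]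
    linarith
  obtain ⟨hsymm, hpos, hT₁, hT₂, hd₁, hd₂⟩ := hsol N hNN₁
  have hcoer : ∀ t ∈ Icc (0 : ℝ) p.T,
      (p.bigR N + (2 : ℝ) • p.M2 N (blockPN N n (Λ₁ N t) (Λ₂ N t))
        - (c₁ / 2) • 1).PosSemidef := by
    intro t ht
    rw [p.bigR_add_M2_blockPN hN0, ← meanSplit_one, meanSplit_smul, meanSplit_sub]
    apply meanSplit_posSemidef hN0
    · have heq : p.R1 (Λ₁ N t) - (c₁ / 2) • 1
          = (p.R1 (Λ₁ N t) - c₁ • 1) + (c₁ / 2) • 1 := by module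
      rw [heq]
      exact (hR N hNN₁ t ht).1.add (Matrix.PosSemidef.one.smul (half_pos hc₁).le)
    · refine posSemidef_sub_smul_sub (hR N hNN₁ t ht).2 ?_ (hentry N hNN₁ t ht)
        (by positivity) hsmall
      rw [Matrix.IsSymm, Matrix.transpose_mul, Matrix.transpose_mul, Matrix.transpose_transpose,
        (hsymm t ht).2.eq, Matrix.mul_assoc]
  refine ⟨fun t => blockPN N n (Λ₁ N t) (Λ₂ N t), ⟨fun t ht => ?_, fun t ht => ?_, ?_,
    fun t ht x y => ?_⟩, fun t ht => l1norm_blockPN_div_le hN0 (hbd N hNN₁ t ht), hcoer⟩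
  · simp only [Matrix.IsSymm]
    rw [blockPN_eq_meanSplit, meanSplit_transpose]
    simp only [Matrix.transpose_sub, Matrix.transpose_add, Matrix.transpose_smul,
      (hsymm t ht).1.eq, (hsymm t ht).2.eq]
  · have h := (Matrix.PosDef.one.smul (half_pos hc₁)).posSemidef_add (hcoer t ht)
    rwa [sub_add_cancel] at h
  · ext x y
    simp only [hT₁, hT₂, blockPN, Params.bigQf, Matrix.of_apply, Matrix.add_apply,
      Matrix.smul_apply, smul_eq_mul]
    split_ifs <;> ring
  · obtain ⟨h₁, -, h₂⟩ := hpos t ht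
    rw [p.PRic_blockPN hN0 _ _ h₁.det_pos.ne'.isUnit h₂.det_pos.ne'.isUnit]
    simp only [blockPN, Matrix.of_apply]
    split_ifs
    · exact hd₁ t ht _ _
    · exact (hd₂ t ht _ _).div_const _

end LQ
end

section
/- If the limiting system (ODE-Λ) has a solution (Λ₁, Λ₂) on [0, T], then there exist N₁ ≥ 1 and a constant C > 0 such that for every N ≥ N₁ the rescaled system (ODE-Λ^N) has a solution (Λ₁^N, Λ₂^N) on [0, T] and sup_{t∈[0,T]} (|Λ₁^N(t) − Λ₁(t)| + |Λ₂^N(t) − Λ₂(t)|) ≤ C/N (|·| the Frobenius norm). -/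
open Matrix Set

section ODE

open Filter Topology Metric
open scoped NNReal

variable {W : Type*} [NormedAddCommGroup W] [NormedSpace ℝ W]

/-- The radial retraction onto the closed ball of radius `δ` around the origin. -/
noncomputable def radialRetract (δ : ℝ) (z : W) : W := (δ / max δ ‖z‖) • z

lemma radialRetract_of_norm_le {δ : ℝ} (hδ : 0 < δ) {z : W} (hz : ‖z‖ ≤ δ) :
    radialRetract δ z = z := by
  rw [radialRetract, max_eq_left hz, div_self hδ.ne', one_smul]

lemma norm_radialRetract_le {δ : ℝ} (hδ : 0 < δ) (z : W) : ‖radialRetract δ z‖ ≤ δ := by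
  have hm : 0 < max δ ‖z‖ := lt_max_of_lt_left hδ
  rw [radialRetract, norm_smul, Real.norm_of_nonneg (by positivity), div_mul_eq_mul_div,
    div_le_iff₀ hm]
  exact mul_le_mul_of_nonneg_left (le_max_right _ _) hδ.le

lemma norm_radialRetract_le_norm {δ : ℝ} (hδ : 0 < δ) (z : W) : ‖radialRetract δ z‖ ≤ ‖z‖ := by
  have hm : 0 < max δ ‖z‖ := lt_max_of_lt_left hδ
  rw [radialRetract, norm_smul, Real.norm_of_nonneg (by positivity)]
  exact mul_le_of_le_one_left (norm_nonneg z) ((div_le_one hm).2 (le_max_left _ _))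

lemma norm_radialRetract_sub_le {δ : ℝ} (hδ : 0 < δ) (z w : W) :
    ‖radialRetract δ z - radialRetract δ w‖ ≤ 2 * ‖z - w‖ := by
  have hz : 0 < max δ ‖z‖ := lt_max_of_lt_left hδ
  have hw : 0 < max δ ‖w‖ := lt_max_of_lt_left hδ
  have hsplit : radialRetract δ z - radialRetract δ w =
      (δ / max δ ‖z‖) • (z - w) + (δ / max δ ‖z‖ - δ / max δ ‖w‖) • w := by
    simp only [radialRetract, smul_sub, sub_smul]; abel
  have h1 : ‖(δ / max δ ‖z‖) • (z - w)‖ ≤ ‖z - w‖ := by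
    rw [norm_smul, Real.norm_of_nonneg (by positivity)]
    exact mul_le_of_le_one_left (norm_nonneg _) ((div_le_one hz).2 (le_max_left _ _))
  have hmax : |max δ ‖w‖ - max δ ‖z‖| ≤ ‖z - w‖ := by
    calc |max δ ‖w‖ - max δ ‖z‖| ≤ |‖w‖ - ‖z‖| := by
          simpa using abs_max_sub_max_le_max δ ‖w‖ δ ‖z‖
      _ ≤ ‖w - z‖ := abs_norm_sub_norm_le _ _
      _ = ‖z - w‖ := norm_sub_rev _ _
  have h2 : ‖(δ / max δ ‖z‖ - δ / max δ ‖w‖) • w‖ ≤ ‖z - w‖ := by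
    have hfac : δ / max δ ‖z‖ - δ / max δ ‖w‖ =
        (δ / max δ ‖z‖) * (max δ ‖w‖ - max δ ‖z‖) / max δ ‖w‖ := by
      field_simp
    rw [norm_smul, hfac, Real.norm_eq_abs, abs_div, abs_mul, abs_of_pos hw,
      abs_of_pos (div_pos hδ hz), div_mul_eq_mul_div, div_le_iff₀ hw]
    have hc : δ / max δ ‖z‖ ≤ 1 := (div_le_one hz).2 (le_max_left _ _)
    calc δ / max δ ‖z‖ * |max δ ‖w‖ - max δ ‖z‖| * ‖w‖
        ≤ 1 * ‖z - w‖ * max δ ‖w‖ := by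
          gcongr
          exact le_max_right _ _
      _ = ‖z - w‖ * max δ ‖w‖ := by ring
  rw [hsplit]
  linarith [norm_add_le ((δ / max δ ‖z‖) • (z - w)) ((δ / max δ ‖z‖ - δ / max δ ‖w‖) • w)]

/-- A map that is `C¹` near a compact set is uniformly Lipschitz on balls of a fixed radius. -/
lemma IsCompact.exists_lipschitzOnWith_closedBall {F : W → W} {U S : Set W} (hS : IsCompact S)
    (hU : IsOpen U) (hSU : S ⊆ U) (hF : ∀ x ∈ U, ContDiffAt ℝ 1 F x) :
    ∃ δ > 0, ∃ K : ℝ≥0, ∀ x ∈ S, closedBall x δ ⊆ U ∧ LipschitzOnWith K F (closedBall x δ) := by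
  refine hS.induction_on (p := fun S => ∃ δ > 0, ∃ K : ℝ≥0, ∀ x ∈ S, closedBall x δ ⊆ U ∧
    LipschitzOnWith K F (closedBall x δ)) ⟨1, one_pos, 0, by simp⟩ ?_ ?_ ?_
  · rintro s t hst ⟨δ, hδ, K, h⟩
    exact ⟨δ, hδ, K, fun x hx => h x (hst hx)⟩
  · rintro s t ⟨δ, hδ, K, h⟩ ⟨δ', hδ', K', h'⟩
    refine ⟨min δ δ', lt_min hδ hδ', max K K', ?_⟩
    rintro x (hx | hx)
    · have hsub := closedBall_subset_closedBall (x := x) (min_le_left δ δ')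
      exact ⟨hsub.trans (h x hx).1, ((h x hx).2.mono hsub).weaken (le_max_left _ _)⟩
    · have hsub := closedBall_subset_closedBall (x := x) (min_le_right δ δ')
      exact ⟨hsub.trans (h' x hx).1, ((h' x hx).2.mono hsub).weaken (le_max_right _ _)⟩
  · intro x hx
    obtain ⟨K, s, hs, hK⟩ := (hF x (hSU hx)).exists_lipschitzOnWith
    obtain ⟨r, hr, hrs⟩ := Metric.mem_nhds_iff.1 (inter_mem hs (hU.mem_nhds (hSU hx)))
    refine ⟨ball x (r / 2), mem_nhdsWithin_of_mem_nhds (ball_mem_nhds x (half_pos hr)),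
      r / 4, by positivity, K, fun y hy => ?_⟩
    have hsub : closedBall y (r / 4) ⊆ s ∩ U := by
      refine Subset.trans (fun z hz => ?_) hrs
      rw [mem_ball] at hy ⊢
      rw [mem_closedBall] at hz
      linarith [dist_triangle z y x]
    exact ⟨hsub.trans inter_subset_right, hK.mono (hsub.trans inter_subset_left)⟩

/-- Grönwall's inequality for terminal data. -/
lemma norm_le_exp_mul_norm_terminal {Z Z' : ℝ → W} {K T : ℝ}
    (hZ : ∀ t ∈ Icc 0 T, HasDerivWithinAt Z (Z' t) (Icc 0 T) t)
    (hK : 0 ≤ K) (bound : ∀ t ∈ Icc 0 T, ‖Z' t‖ ≤ K * ‖Z t‖) :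
    ∀ t ∈ Icc 0 T, ‖Z t‖ ≤ ‖Z T‖ * Real.exp (K * T) := by
  have hmaps : MapsTo (fun s => T - s) (Icc 0 T) (Icc 0 T) := fun s hs =>
    ⟨by linarith [hs.2], by linarith [hs.1]⟩
  have hrev : ∀ s ∈ Icc 0 T,
      HasDerivWithinAt (fun s => Z (T - s)) (-Z' (T - s)) (Icc 0 T) s := fun s hs => by
    simpa [Function.comp_def] using (hZ _ (hmaps hs)).scomp s ((hasDerivWithinAt_id s _).const_sub T) hmaps
  have key := norm_le_gronwallBound_of_norm_deriv_right_le (f := fun s => Z (T - s))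
    (f' := fun s => -Z' (T - s)) (a := 0) (b := T) (δ := ‖Z T‖) (K := K) (ε := 0)
    (fun s hs => (hrev s hs).continuousWithinAt)
    (fun s hs => (hrev s (Ico_subset_Icc_self hs)).mono_of_mem_nhdsWithin
      (Icc_mem_nhdsGE_of_mem hs))
    (by simp) (fun s hs => by simpa using bound _ (hmaps (Ico_subset_Icc_self hs)))
  intro t ht
  have := key (T - t) (hmaps ht)
  simp only [gronwallBound_ε0, sub_sub_cancel, sub_zero] at this
  refine this.trans ?_
  gcongr
  linarith [ht.1]

/-- Lipschitz dependence on terminal data, with existence, for an autonomous `C¹` ODE: solutions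
with terminal value near that of a given solution exist on the same time interval. -/
theorem exists_solution_near [CompleteSpace W] {F : W → W} {U : Set W} {T : ℝ} (hT : 0 ≤ T)
    (hU : IsOpen U) (hF : ∀ x ∈ U, ContDiffAt ℝ 1 F x) {X : ℝ → W}
    (hX : ∀ t ∈ Icc 0 T, HasDerivWithinAt X (F (X t)) (Icc 0 T) t)
    (hXU : ∀ t ∈ Icc 0 T, X t ∈ U) :
    ∃ η > 0, ∃ C > 0, ∀ y : W, ‖y - X T‖ ≤ η → ∃ Y : ℝ → W, Y T = y ∧
      ∀ t ∈ Icc 0 T, HasDerivWithinAt Y (F (Y t)) (Icc 0 T) t ∧ Y t ∈ U ∧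
        ‖Y t - X t‖ ≤ C * ‖y - X T‖ := by
  have hXc : ContinuousOn X (Icc 0 T) := fun t ht => (hX t ht).continuousWithinAt
  obtain ⟨δ, hδ, K, hK⟩ :=
    (isCompact_Icc.image_of_continuousOn hXc).exists_lipschitzOnWith_closedBall hU
      (by rintro _ ⟨t, ht, rfl⟩; exact hXU t ht) hF
  replace hK := fun t ht => hK (X t) (mem_image_of_mem X ht)
  have hTmem : T ∈ Icc 0 T := right_mem_Icc.2 hT
  have hmem : ∀ t z, X t + radialRetract δ z ∈ closedBall (X t) δ := fun t z => by
    simpa [mem_closedBall, dist_eq_norm] using norm_radialRetract_le hδ z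
  have hbound : ∀ t ∈ Icc 0 T, ∀ z,
      ‖F (X t + radialRetract δ z) - F (X t)‖ ≤ K * ‖radialRetract δ z‖ := fun t ht z => by
    simpa using (hK t ht).2.norm_sub_le (hmem t z) (mem_closedBall_self hδ.le)
  refine ⟨δ * Real.exp (-(K * T)), by positivity, Real.exp (K * T), by positivity, fun y hy => ?_⟩
  have hPL : IsPicardLindelof (fun t z => F (X t + radialRetract δ z) - F (X t))
      (⟨T, hTmem⟩ : Icc 0 T) (y - X T) (K * ⟨δ, hδ.le⟩ * ⟨T, hT⟩) 0 (K * ⟨δ, hδ.le⟩) (K * 2) := by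
    refine ⟨fun t ht => LipschitzWith.lipschitzOnWith ?_, fun z _ => ?_, fun t ht z _ => ?_, ?_⟩
    · refine LipschitzWith.of_dist_le_mul fun z w => ?_
      have h1 := (hK t ht).2.norm_sub_le (hmem t z) (hmem t w)
      have h2 := norm_radialRetract_sub_le hδ z w
      rw [add_sub_add_left_eq_sub] at h1
      rw [dist_sub_right, dist_eq_norm, dist_eq_norm]
      push_cast
      calc _ ≤ _ := h1
        _ ≤ K * (2 * ‖z - w‖) := by gcongr
        _ = _ := by ring
    · intro t ht
      refine ContinuousWithinAt.sub ?_ ?_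
      · exact (hF _ ((hK t ht).1 (hmem t z))).continuousAt.comp_continuousWithinAt
          (f := fun s => X s + radialRetract δ z) ((hXc t ht).add continuousWithinAt_const)
      · exact (hF _ (hXU t ht)).continuousAt.comp_continuousWithinAt (hXc t ht)
    · refine (hbound t ht z).trans ?_
      exact mul_le_mul_of_nonneg_left (norm_radialRetract_le hδ z) K.2
    · simp only [sub_self, NNReal.coe_zero, sub_zero, max_eq_right hT]
      exact le_of_eq rfl
  obtain ⟨Z, hZT, hZ⟩ := hPL.exists_eq_forall_mem_Icc_hasDerivWithinAt₀
  change Z T = _ at hZT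
  have hZle := norm_le_exp_mul_norm_terminal hZ K.2 fun t ht =>
    (hbound t ht _).trans
      (mul_le_mul_of_nonneg_left (norm_radialRetract_le_norm hδ _) K.2)
  have hZδ : ∀ t ∈ Icc 0 T, ‖Z t‖ ≤ δ := fun t ht => by
    refine (hZle t ht).trans ?_
    rw [hZT]
    calc _ ≤ δ * Real.exp (-(K * T)) * Real.exp (K * T) := by gcongr; exact le_rfl
      _ = δ := by rw [mul_assoc, ← Real.exp_add]; simp
  refine ⟨fun t => X t + Z t, by simp [hZT], fun t ht => ⟨?_, ?_, ?_⟩⟩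
  · have := (hX t ht).add (hZ t ht)
    rwa [radialRetract_of_norm_le hδ (hZδ t ht), add_sub_cancel] at this
  · exact (hK t ht).1 (by simpa [dist_eq_norm] using hZδ t ht)
  · rw [add_sub_cancel_left, ← hZT, mul_comm]
    exact hZle t ht

end ODE

section MatrixCalculus

open scoped Matrix.Norms.Elementwise Topology ContDiff

variable {W : Type*} [NormedAddCommGroup W] [NormedSpace ℝ W]
  {a b c : Type*} [Fintype a] [Fintype b] [Fintype c] {k : ℕ∞ω} {w : W}

lemma contDiffAt_matrix {f : W → Matrix a b ℝ} :
    ContDiffAt ℝ k f w ↔ ∀ i j, ContDiffAt ℝ k (fun x => f x i j) w :=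
  contDiffAt_pi.trans (forall_congr' fun _ => contDiffAt_pi)

lemma hasDerivWithinAt_matrix {a b : Type*} [Finite a] [Fintype b] {f : ℝ → Matrix a b ℝ}
    {f' : Matrix a b ℝ} {s : Set ℝ} {t : ℝ} :
    HasDerivWithinAt f f' s t ↔ ∀ i j, HasDerivWithinAt (fun x => f x i j) (f' i j) s t :=
  hasDerivWithinAt_pi.trans (forall_congr' fun _ => hasDerivWithinAt_pi)

@[fun_prop]
lemma ContDiffAt.matrix_mul {f : W → Matrix a b ℝ} {g : W → Matrix b c ℝ}
    (hf : ContDiffAt ℝ k f w) (hg : ContDiffAt ℝ k g w) :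
    ContDiffAt ℝ k (fun x => f x * g x) w := by
  rw [contDiffAt_matrix] at *
  intro i j
  simp only [Matrix.mul_apply]
  exact ContDiffAt.sum fun l _ => (hf i l).mul (hg l j)

@[fun_prop]
lemma ContDiffAt.matrix_transpose {f : W → Matrix a b ℝ} (hf : ContDiffAt ℝ k f w) :
    ContDiffAt ℝ k (fun x => (f x)ᵀ) w := by
  rw [contDiffAt_matrix] at *
  exact fun i j => hf j i

lemma ContDiffAt.matrix_det [DecidableEq a] {f : W → Matrix a a ℝ} (hf : ContDiffAt ℝ k f w) :
    ContDiffAt ℝ k (fun x => (f x).det) w := by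
  rw [contDiffAt_matrix] at hf
  simp only [Matrix.det_apply]
  exact ContDiffAt.sum fun σ _ => (contDiffAt_prod fun i _ => hf _ i).const_smul _

lemma ContDiffAt.matrix_adjugate [DecidableEq a] {f : W → Matrix a a ℝ}
    (hf : ContDiffAt ℝ k f w) : ContDiffAt ℝ k (fun x => (f x).adjugate) w := by
  refine contDiffAt_matrix.2 fun i j => ?_
  simp only [Matrix.adjugate_apply]
  refine ContDiffAt.matrix_det (contDiffAt_matrix.2 fun r s => ?_)
  rcases eq_or_ne r j with rfl | hr
  · simpa using contDiffAt_const
  · simpa [Matrix.updateRow_ne hr] using contDiffAt_matrix.1 hf r s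

lemma ContDiffAt.matrix_inv [DecidableEq a] {f : W → Matrix a a ℝ} (hf : ContDiffAt ℝ k f w)
    (h : IsUnit (f w)) : ContDiffAt ℝ k (fun x => (f x)⁻¹) w := by
  simp only [Matrix.inv_def, Ring.inverse_eq_inv']
  exact (hf.matrix_det.inv ((Matrix.isUnit_iff_isUnit_det _).1 h).ne_zero).smul hf.matrix_adjugate

/-- Positive definiteness is an open condition on symmetric matrices. -/
lemma isOpen_setOf_posDef {X : Type*} [TopologicalSpace X] {f : X → Matrix a a ℝ}
    (hf : Continuous f) (hs : ∀ x, (f x).IsSymm) : IsOpen {x | (f x).PosDef} := by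
  have hset : {x | (f x).PosDef} =
      {x | ∀ v ∈ Metric.sphere (0 : a → ℝ) 1, 0 < v ⬝ᵥ (f x *ᵥ v)} := by
    ext x
    constructor
    · intro h v hv
      have hv0 : v ≠ 0 := by
        rintro rfl
        simp at hv
      simpa using h.dotProduct_mulVec_pos hv0
    · intro h
      refine Matrix.PosDef.of_dotProduct_mulVec_pos
        ((Matrix.conjTranspose_eq_transpose_of_trivial _).trans (hs x))
        fun v hv => ?_
      have hv' : 0 < ‖v‖ := norm_pos_iff.2 hv
      have := h (‖v‖⁻¹ • v) (by simp [norm_smul, hv'.ne'])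
      rw [Matrix.mulVec_smul, smul_dotProduct, dotProduct_smul, smul_smul, smul_eq_mul] at this
      simpa using pos_of_mul_pos_right this (by positivity)
  rw [hset, isOpen_iff_mem_nhds]
  intro x hx
  refine (isCompact_sphere _ _).eventually_forall_of_forall_eventually fun v hv => ?_
  have hc : Continuous fun q : X × (a → ℝ) => q.2 ⬝ᵥ (f q.1 *ᵥ q.2) :=
    continuous_snd.dotProduct ((hf.comp continuous_fst).matrix_mulVec continuous_snd)
  exact hc.continuousAt.eventually (lt_mem_nhds (hx v hv))

end MatrixCalculus

namespace LQ

open scoped Matrix.Norms.Elementwise ContDiff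

lemma frob_le_mul_norm {n : ℕ} (M : Matrix (Fin n) (Fin n) ℝ) : frob M ≤ n * ‖M‖ := by
  refine Real.sqrt_le_iff.2 ⟨by positivity, ?_⟩
  calc ∑ i, ∑ j, M i j ^ 2 ≤ ∑ _i : Fin n, ∑ _j : Fin n, ‖M‖ ^ 2 := by
        refine Finset.sum_le_sum fun i _ => Finset.sum_le_sum fun j _ => ?_
        rw [← sq_abs]
        exact pow_le_pow_left₀ (abs_nonneg _) (Matrix.norm_entry_le_entrywise_sup_norm M) 2
    _ = (n * ‖M‖) ^ 2 := by simp; ring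

/-- The symmetric part of a square matrix. -/
noncomputable def symmPart {n : ℕ} (L : Matrix (Fin n) (Fin n) ℝ) : Matrix (Fin n) (Fin n) ℝ :=
  (1 / 2 : ℝ) • (L + Lᵀ)

lemma isSymm_symmPart {n : ℕ} (L : Matrix (Fin n) (Fin n) ℝ) : (symmPart L).IsSymm := by
  simp [symmPart, Matrix.IsSymm, add_comm]

lemma symmPart_of_isSymm {n : ℕ} {L : Matrix (Fin n) (Fin n) ℝ} (hL : L.IsSymm) :
    symmPart L = L := by
  rw [symmPart, hL.eq, ← two_smul ℝ L, smul_smul]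
  norm_num

namespace Params

variable {n n₁ : ℕ} (p : Params n n₁)

/-- The perturbed matrix `ℛ₂ − ε B₀ᵀ Λ₂ B₀`. -/
def R2Eps (ε : ℝ) (L₁ L₂ : Matrix (Fin n) (Fin n) ℝ) : Matrix (Fin n₁) (Fin n₁) ℝ :=
  p.R2 L₁ L₂ - ε • (p.B0ᵀ * L₂ * p.B0)

/-- `N E^N` with `1/N` replaced by a real parameter `ε`. -/
noncomputable def invDiff (ε : ℝ) (L₁ L₂ : Matrix (Fin n) (Fin n) ℝ) :
    Matrix (Fin n₁) (Fin n₁) ℝ :=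
  (p.R2Eps ε L₁ L₂)⁻¹ - (p.R1 L₁)⁻¹

/-- `Ψ₁ + g₁` with `1/N` replaced by a real parameter `ε`. -/
noncomputable def rhs₁ (ε : ℝ) (L₁ L₂ : Matrix (Fin n) (Fin n) ℝ) : Matrix (Fin n) (Fin n) ℝ :=
  p.Ψ₁ L₁ +
  (L₁ * p.B * (ε • p.invDiff ε L₁ L₂) * p.Bᵀ * L₁
  + (1 - ε) • (L₂ * p.B * (ε • p.invDiff ε L₁ L₂) * p.Bᵀ * L₁
      + L₁ * p.B * (ε • p.invDiff ε L₁ L₂) * p.Bᵀ * L₂)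
  + (ε - ε ^ 2) • (L₂ * p.B * (ε • p.invDiff ε L₁ L₂ + (p.R1 L₁)⁻¹
      + (1 - 2 * ε) • p.invDiff ε L₁ L₂) * p.Bᵀ * L₂)
  - ε • ((L₁ * p.G + p.Gᵀ * L₁) + (1 - ε) • (L₂ * p.G + p.Gᵀ * L₂))
  - ε • p.QΓ)

/-- `Ψ₂ + g₂` with `1/N` replaced by a real parameter `ε`. -/
noncomputable def rhs₂ (ε : ℝ) (L₁ L₂ : Matrix (Fin n) (Fin n) ℝ) : Matrix (Fin n) (Fin n) ℝ :=
  p.Ψ₂ L₁ L₂ +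
  ((L₁ + L₂) * p.B * (p.invDiff ε L₁ L₂ + (p.R1 L₁)⁻¹ - (p.R2 L₁ L₂)⁻¹) * p.Bᵀ * (L₁ + L₂)
  - (2 * ε) • (L₂ * p.B * (p.R1 L₁)⁻¹ * p.Bᵀ * L₂)
  + (ε - 2) • (L₂ * p.B * (ε • p.invDiff ε L₁ L₂) * p.Bᵀ * L₂)
  - L₁ * p.B * (ε • p.invDiff ε L₁ L₂) * p.Bᵀ * L₂
  - L₂ * p.B * (ε • p.invDiff ε L₁ L₂) * p.Bᵀ * L₁
  + ε • (L₂ * p.G + p.Gᵀ * L₂))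

lemma rhs₁_zero (L₁ L₂ : Matrix (Fin n) (Fin n) ℝ) : p.rhs₁ 0 L₁ L₂ = p.Ψ₁ L₁ := by
  simp [rhs₁]

lemma rhs₂_zero (L₁ L₂ : Matrix (Fin n) (Fin n) ℝ) : p.rhs₂ 0 L₁ L₂ = p.Ψ₂ L₁ L₂ := by
  simp [rhs₂, invDiff, R2Eps]

lemma rhs₁_one_div {N : ℕ} (hN : N ≠ 0) (L₁ L₂ : Matrix (Fin n) (Fin n) ℝ) :
    p.rhs₁ (1 / (N : ℝ)) L₁ L₂ = p.Ψ₁ L₁ + p.g₁ N L₁ L₂ := by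
  have hE : ((N : ℝ) - 2) • p.EN N L₁ L₂
      = (1 - 2 * (1 / (N : ℝ))) • p.invDiff (1 / (N : ℝ)) L₁ L₂ := by
    rw [EN, smul_smul]
    congr 1
    field_simp
  rw [g₁, hE, HN, ← _root_.one_div_pow]
  rfl

lemma rhs₂_one_div {N : ℕ} (hN : N ≠ 0) (L₁ L₂ : Matrix (Fin n) (Fin n) ℝ) :
    p.rhs₂ (1 / (N : ℝ)) L₁ L₂ = p.Ψ₂ L₁ L₂ + p.g₂ N L₁ L₂ := by
  have hE : (N : ℝ) • p.EN N L₁ L₂ = p.invDiff (1 / (N : ℝ)) L₁ L₂ := by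
    rw [EN, smul_smul, mul_one_div_cancel (by exact_mod_cast hN), one_smul]
    rfl
  rw [g₂, hE, show (2 : ℝ) / N = 2 * (1 / N) by ring]
  rfl

section Symmetry

variable {p} {L₁ L₂ : Matrix (Fin n) (Fin n) ℝ}

lemma isSymm_R1 (hp : p.Standing) (h₁ : L₁.IsSymm) : (p.R1 L₁).IsSymm := by
  obtain ⟨-, -, -, -, -, hR⟩ := hp
  simp [Matrix.IsSymm, R1, hR.eq, h₁.eq, Matrix.mul_assoc]

lemma isSymm_R2 (hp : p.Standing) (h₁ : L₁.IsSymm) (h₂ : L₂.IsSymm) :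
    (p.R2 L₁ L₂).IsSymm := by
  obtain ⟨-, -, -, -, -, hR⟩ := hp
  simp [Matrix.IsSymm, R2, hR.eq, h₁.eq, h₂.eq, Matrix.mul_assoc]

lemma isSymm_R2Eps (hp : p.Standing) (h₁ : L₁.IsSymm) (h₂ : L₂.IsSymm) (ε : ℝ) :
    (p.R2Eps ε L₁ L₂).IsSymm := by
  have h := isSymm_R2 hp h₁ h₂
  simp [Matrix.IsSymm, R2Eps, h.eq, h₂.eq, Matrix.mul_assoc]

lemma isSymm_invDiff (hp : p.Standing) (h₁ : L₁.IsSymm) (h₂ : L₂.IsSymm) (ε : ℝ) :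
    (p.invDiff ε L₁ L₂).IsSymm := by
  simp [Matrix.IsSymm, invDiff, Matrix.transpose_nonsing_inv, (isSymm_R1 hp h₁).eq,
    (isSymm_R2Eps hp h₁ h₂ ε).eq]

lemma isSymm_rhs₁ (hp : p.Standing) (h₁ : L₁.IsSymm) (h₂ : L₂.IsSymm) (ε : ℝ) :
    (p.rhs₁ ε L₁ L₂).IsSymm := by
  have hD := (isSymm_invDiff hp h₁ h₂ ε).eq
  have hR := (isSymm_R1 hp h₁).eq
  obtain ⟨-, -, -, hQ, -, -⟩ := hp
  simp only [Matrix.IsSymm, rhs₁, Ψ₁, QΓ, transpose_add, transpose_sub, transpose_mul,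
    transpose_smul, transpose_transpose, transpose_nonsing_inv, hD, hR, hQ.eq, h₁.eq, h₂.eq,
    Matrix.mul_assoc, smul_add, smul_sub]
  abel

lemma isSymm_rhs₂ (hp : p.Standing) (h₁ : L₁.IsSymm) (h₂ : L₂.IsSymm) (ε : ℝ) :
    (p.rhs₂ ε L₁ L₂).IsSymm := by
  have hD := (isSymm_invDiff hp h₁ h₂ ε).eq
  have hR := (isSymm_R1 hp h₁).eq
  have hR2 := (isSymm_R2 hp h₁ h₂).eq
  obtain ⟨-, -, -, hQ, -, -⟩ := hp
  simp only [Matrix.IsSymm, rhs₂, Ψ₂, QΓ, transpose_add, transpose_sub, transpose_mul,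
    transpose_smul, transpose_transpose, transpose_nonsing_inv, hD, hR, hR2, hQ.eq, h₁.eq, h₂.eq,
    Matrix.mul_assoc, smul_add, Matrix.mul_add, Matrix.add_mul]
  abel

end Symmetry

section Smoothness

variable {W : Type*} [NormedAddCommGroup W] [NormedSpace ℝ W] {ε : W → ℝ}
  {L₁ L₂ : W → Matrix (Fin n) (Fin n) ℝ} {w : W}

lemma contDiffAt_R1 (h₁ : ContDiffAt ℝ 1 L₁ w) : ContDiffAt ℝ 1 (fun x => p.R1 (L₁ x)) w := by
  unfold R1
  fun_prop

lemma contDiffAt_R2 (h₁ : ContDiffAt ℝ 1 L₁ w) (h₂ : ContDiffAt ℝ 1 L₂ w) :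
    ContDiffAt ℝ 1 (fun x => p.R2 (L₁ x) (L₂ x)) w := by
  unfold R2
  fun_prop

lemma contDiffAt_R2Eps (hε : ContDiffAt ℝ 1 ε w) (h₁ : ContDiffAt ℝ 1 L₁ w)
    (h₂ : ContDiffAt ℝ 1 L₂ w) : ContDiffAt ℝ 1 (fun x => p.R2Eps (ε x) (L₁ x) (L₂ x)) w := by
  have := p.contDiffAt_R2 h₁ h₂
  unfold R2Eps
  fun_prop

lemma contDiffAt_invDiff (hε : ContDiffAt ℝ 1 ε w) (h₁ : ContDiffAt ℝ 1 L₁ w)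
    (h₂ : ContDiffAt ℝ 1 L₂ w) (hR1 : IsUnit (p.R1 (L₁ w)))
    (hR2ε : IsUnit (p.R2Eps (ε w) (L₁ w) (L₂ w))) :
    ContDiffAt ℝ 1 (fun x => p.invDiff (ε x) (L₁ x) (L₂ x)) w :=
  ((p.contDiffAt_R2Eps hε h₁ h₂).matrix_inv hR2ε).sub ((p.contDiffAt_R1 h₁).matrix_inv hR1)

lemma contDiffAt_rhs₁ (hε : ContDiffAt ℝ 1 ε w) (h₁ : ContDiffAt ℝ 1 L₁ w)
    (h₂ : ContDiffAt ℝ 1 L₂ w) (hR1 : IsUnit (p.R1 (L₁ w)))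
    (hR2ε : IsUnit (p.R2Eps (ε w) (L₁ w) (L₂ w))) :
    ContDiffAt ℝ 1 (fun x => p.rhs₁ (ε x) (L₁ x) (L₂ x)) w := by
  have hD := p.contDiffAt_invDiff hε h₁ h₂ hR1 hR2ε
  have hI := (p.contDiffAt_R1 h₁).matrix_inv hR1
  unfold rhs₁ Ψ₁
  fun_prop

lemma contDiffAt_rhs₂ (hε : ContDiffAt ℝ 1 ε w) (h₁ : ContDiffAt ℝ 1 L₁ w)
    (h₂ : ContDiffAt ℝ 1 L₂ w) (hR1 : IsUnit (p.R1 (L₁ w)))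
    (hR2 : IsUnit (p.R2 (L₁ w) (L₂ w)))
    (hR2ε : IsUnit (p.R2Eps (ε w) (L₁ w) (L₂ w))) :
    ContDiffAt ℝ 1 (fun x => p.rhs₂ (ε x) (L₁ x) (L₂ x)) w := by
  have hD := p.contDiffAt_invDiff hε h₁ h₂ hR1 hR2ε
  have hI := (p.contDiffAt_R1 h₁).matrix_inv hR1
  have hI2 := (p.contDiffAt_R2 h₁ h₂).matrix_inv hR2
  unfold rhs₂ Ψ₂
  fun_prop

end Smoothness

/-- The rescaled system as an autonomous vector field in which `ε = 1/N` is a constant state. -/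
noncomputable def field (w : ℝ × Matrix (Fin n) (Fin n) ℝ × Matrix (Fin n) (Fin n) ℝ) :
    ℝ × Matrix (Fin n) (Fin n) ℝ × Matrix (Fin n) (Fin n) ℝ :=
  (0, p.rhs₁ w.1 (symmPart w.2.1) (symmPart w.2.2), p.rhs₂ w.1 (symmPart w.2.1) (symmPart w.2.2))

/-- The states at which the three weight matrices are positive definite. -/
def admissible : Set (ℝ × Matrix (Fin n) (Fin n) ℝ × Matrix (Fin n) (Fin n) ℝ) :=
  {w | (p.R1 (symmPart w.2.1)).PosDef} ∩
    ({w | (p.R2 (symmPart w.2.1) (symmPart w.2.2)).PosDef} ∩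
      {w | (p.R2Eps w.1 (symmPart w.2.1) (symmPart w.2.2)).PosDef})

lemma contDiff_symmPart {k : ℕ∞ω} :
    ContDiff ℝ k (symmPart : Matrix (Fin n) (Fin n) ℝ → Matrix (Fin n) (Fin n) ℝ) := by
  unfold symmPart
  refine contDiff_iff_contDiffAt.2 fun _ => ?_
  fun_prop

lemma contDiffAt_symmPart_fst (w : ℝ × Matrix (Fin n) (Fin n) ℝ × Matrix (Fin n) (Fin n) ℝ) :
    ContDiffAt ℝ 1 (fun x : ℝ × Matrix (Fin n) (Fin n) ℝ × Matrix (Fin n) (Fin n) ℝ =>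
      symmPart x.2.1) w :=
  (contDiff_symmPart.comp (contDiff_fst.comp contDiff_snd)).contDiffAt

lemma contDiffAt_symmPart_snd (w : ℝ × Matrix (Fin n) (Fin n) ℝ × Matrix (Fin n) (Fin n) ℝ) :
    ContDiffAt ℝ 1 (fun x : ℝ × Matrix (Fin n) (Fin n) ℝ × Matrix (Fin n) (Fin n) ℝ =>
      symmPart x.2.2) w :=
  (contDiff_symmPart.comp (contDiff_snd.comp contDiff_snd)).contDiffAt

lemma isOpen_admissible (hp : p.Standing) : IsOpen p.admissible := by
  refine .inter ?_ (.inter ?_ ?_)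
  · exact isOpen_setOf_posDef (continuous_iff_continuousAt.2 fun w =>
      (p.contDiffAt_R1 (contDiffAt_symmPart_fst w)).continuousAt)
      fun w => isSymm_R1 hp (isSymm_symmPart _)
  · exact isOpen_setOf_posDef (continuous_iff_continuousAt.2 fun w =>
      (p.contDiffAt_R2 (contDiffAt_symmPart_fst w) (contDiffAt_symmPart_snd w)).continuousAt)
      fun w => isSymm_R2 hp (isSymm_symmPart _) (isSymm_symmPart _)
  · exact isOpen_setOf_posDef (continuous_iff_continuousAt.2 fun w =>
      (p.contDiffAt_R2Eps contDiffAt_fst (contDiffAt_symmPart_fst w)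
        (contDiffAt_symmPart_snd w)).continuousAt)
      fun w => isSymm_R2Eps hp (isSymm_symmPart _) (isSymm_symmPart _) _

lemma contDiffAt_field {w : ℝ × Matrix (Fin n) (Fin n) ℝ × Matrix (Fin n) (Fin n) ℝ}
    (hw : w ∈ p.admissible) : ContDiffAt ℝ 1 p.field w := by
  obtain ⟨h1, h2, h3⟩ := hw
  have hs₁ := contDiffAt_symmPart_fst w
  have hs₂ := contDiffAt_symmPart_snd w
  exact contDiffAt_const.prodMk
    ((p.contDiffAt_rhs₁ contDiffAt_fst hs₁ hs₂ h1.isUnit h3.isUnit).prodMk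
      (p.contDiffAt_rhs₂ contDiffAt_fst hs₁ hs₂ h1.isUnit h2.isUnit h3.isUnit))

end Params

/-- A matrix curve with symmetric derivative and symmetric terminal value is symmetric. -/
lemma isSymm_of_hasDerivWithinAt {n : ℕ} {T : ℝ} {L L' : ℝ → Matrix (Fin n) (Fin n) ℝ}
    (hL : ∀ t ∈ Icc 0 T, HasDerivWithinAt L (L' t) (Icc 0 T) t)
    (hL' : ∀ t ∈ Icc 0 T, (L' t).IsSymm) (hT : (L T).IsSymm) :
    ∀ t ∈ Icc 0 T, (L t).IsSymm := by
  intro t ht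
  ext i j
  have hd : ∀ s ∈ Icc 0 T, HasDerivWithinAt (fun s => L s j i - L s i j) 0 (Icc 0 T) s := by
    intro s hs
    have h := hasDerivWithinAt_matrix.1 (hL s hs)
    have := (h j i).sub (h i j)
    rwa [(hL' s hs).apply i j, sub_self] at this
  have := norm_le_exp_mul_norm_terminal hd le_rfl (by simp) t ht
  simp only [hT.apply i j, sub_self, norm_zero, zero_mul, norm_le_zero_iff] at this
  exact sub_eq_zero.1 this

/-- if (ODE-Λ) is solvable on [0,T], then for all large N the rescaled
system (ODE-Λ^N) is solvable and its solution is within O(1/N) of (Λ₁, Λ₂). -/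
theorem solLim_implies_solLamN_close {n n₁ : ℕ} (p : Params n n₁) (hp : p.Standing)
    (Λ₁ Λ₂ : ℝ → Matrix (Fin n) (Fin n) ℝ) (hLim : p.IsSolLim Λ₁ Λ₂) :
    ∃ N₁ : ℕ, 1 ≤ N₁ ∧ ∃ C : ℝ, 0 < C ∧
      ∀ N : ℕ, N₁ ≤ N →
        ∃ Λ₁N Λ₂N : ℝ → Matrix (Fin n) (Fin n) ℝ,
          p.IsSolLamN N Λ₁N Λ₂N ∧
          ∀ t ∈ Icc (0 : ℝ) p.T,
            frob (Λ₁N t - Λ₁ t) + frob (Λ₂N t - Λ₂ t) ≤ C / (N : ℝ) := by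
  obtain ⟨hsymm, hpos, hT₁, hT₂, hd₁, hd₂⟩ := hLim
  obtain ⟨hn, -, hT, hQ, hQf, hR⟩ := id hp
  have hX : ∀ t ∈ Icc 0 p.T, HasDerivWithinAt (fun s => ((0 : ℝ), Λ₁ s, Λ₂ s))
      (p.field (0, Λ₁ t, Λ₂ t)) (Icc 0 p.T) t := by
    intro t ht
    simp only [Params.field, symmPart_of_isSymm (hsymm t ht).1, symmPart_of_isSymm (hsymm t ht).2,
      p.rhs₁_zero, p.rhs₂_zero]
    exact (hasDerivWithinAt_const _ _ _).prodMk
      ((hasDerivWithinAt_matrix.2 (hd₁ t ht)).prodMk (hasDerivWithinAt_matrix.2 (hd₂ t ht)))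
  have hXU : ∀ t ∈ Icc 0 p.T, ((0 : ℝ), Λ₁ t, Λ₂ t) ∈ p.admissible := by
    intro t ht
    simp only [Params.admissible, mem_inter_iff, mem_ofPred_eq, Params.R2Eps, zero_smul, sub_zero,
      symmPart_of_isSymm (hsymm t ht).1, symmPart_of_isSymm (hsymm t ht).2]
    exact ⟨(hpos t ht).1, (hpos t ht).2, (hpos t ht).2⟩
  obtain ⟨η, hη, C, hC, hnear⟩ := exists_solution_near hT.le (p.isOpen_admissible hp)
    (fun _ => p.contDiffAt_field) hX hXU
  have hQfΓ : p.QfΓ.IsSymm := by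
    simp only [Matrix.IsSymm, Params.QfΓ, transpose_sub, transpose_mul, transpose_transpose, hQf.eq,
      Matrix.mul_assoc]
    abel
  set c : ℝ := 1 + ‖p.QfΓ‖
  have hc0 : 0 < c := by positivity
  have hn0 : (0 : ℝ) < n := by exact_mod_cast hn
  refine ⟨max 1 ⌈c / η⌉₊, le_max_left _ _, 2 * n * C * c, by positivity, fun N hN => ?_⟩
  have hN1 : 1 ≤ N := (le_max_left _ _).trans hN
  have hN0 : (0 : ℝ) < N := by exact_mod_cast hN1
  have hdist : ‖((1 / (N : ℝ)), p.Qf + (1 / (N : ℝ)) • p.QfΓ, p.QfΓ)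
      - ((0 : ℝ), Λ₁ p.T, Λ₂ p.T)‖ ≤ c / N := by
    rw [hT₁, hT₂]
    simp only [Prod.mk_sub_mk, sub_zero, add_sub_cancel_left, sub_self, Prod.norm_mk, norm_smul,
      norm_zero, Real.norm_of_nonneg (one_div_pos.2 hN0).le]
    have hle : 1 / (N : ℝ) * ‖p.QfΓ‖ ≤ c / N := by
      rw [one_div_mul_eq_div]
      gcongr
      linarith
    refine max_le ?_ (max_le hle (by positivity))
    gcongr
    linarith [norm_nonneg p.QfΓ]
  have hcη : c / N ≤ η := by
    rw [div_le_comm₀ hN0 hη]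
    exact (Nat.le_ceil _).trans (by exact_mod_cast (le_max_right _ _).trans hN)
  obtain ⟨Y, hYT, hY⟩ := hnear _ (hdist.trans hcη)
  have hYd := fun t ht => (hY t ht).1
  have hTmem : p.T ∈ Icc 0 p.T := right_mem_Icc.2 hT.le
  have hd0 : ∀ t ∈ Icc 0 p.T, HasDerivWithinAt (fun s => (Y s).1) 0 (Icc 0 p.T) t :=
    fun t ht => (hYd t ht).fst
  have hd1 : ∀ t ∈ Icc 0 p.T, HasDerivWithinAt (fun s => (Y s).2.1)
      (p.rhs₁ (Y t).1 (symmPart (Y t).2.1) (symmPart (Y t).2.2)) (Icc 0 p.T) t :=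
    fun t ht => (hYd t ht).snd.fst
  have hd2 : ∀ t ∈ Icc 0 p.T, HasDerivWithinAt (fun s => (Y s).2.2)
      (p.rhs₂ (Y t).1 (symmPart (Y t).2.1) (symmPart (Y t).2.2)) (Icc 0 p.T) t :=
    fun t ht => (hYd t ht).snd.snd
  have hε : ∀ t ∈ Icc 0 p.T, (Y t).1 = 1 / N := by
    intro t ht
    have := norm_le_exp_mul_norm_terminal (fun t ht => (hd0 t ht).sub_const (1 / (N : ℝ))) le_rfl
      (by simp) t ht
    simp only [hYT, sub_self, norm_zero, zero_mul, norm_le_zero_iff] at this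
    exact sub_eq_zero.1 this
  have hs1 : ∀ t ∈ Icc 0 p.T, (Y t).2.1.IsSymm := isSymm_of_hasDerivWithinAt hd1
    (fun t _ => Params.isSymm_rhs₁ hp (isSymm_symmPart _) (isSymm_symmPart _) _)
    (by rw [hYT]; exact hQf.add (hQfΓ.smul _))
  have hs2 : ∀ t ∈ Icc 0 p.T, (Y t).2.2.IsSymm := isSymm_of_hasDerivWithinAt hd2
    (fun t _ => Params.isSymm_rhs₂ hp (isSymm_symmPart _) (isSymm_symmPart _) _)
    (by rw [hYT]; exact hQfΓ)
  have hNne : N ≠ 0 := by omega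
  refine ⟨fun t => (Y t).2.1, fun t => (Y t).2.2, ⟨fun t ht => ⟨hs1 t ht, hs2 t ht⟩, ?_,
    by simp [hYT], by simp [hYT], ?_, ?_⟩, ?_⟩
  · intro t ht
    obtain ⟨h1, h2, h3⟩ := (hY t ht).2.1
    simp only [mem_ofPred_eq, Params.R2Eps, symmPart_of_isSymm (hs1 t ht),
      symmPart_of_isSymm (hs2 t ht), hε t ht] at h1 h2 h3
    exact ⟨h1, h2, h3⟩
  · intro t ht
    have := hd1 t ht
    rw [symmPart_of_isSymm (hs1 t ht), symmPart_of_isSymm (hs2 t ht), hε t ht,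
      p.rhs₁_one_div hNne] at this
    exact hasDerivWithinAt_matrix.1 this
  · intro t ht
    have := hd2 t ht
    rw [symmPart_of_isSymm (hs1 t ht), symmPart_of_isSymm (hs2 t ht), hε t ht,
      p.rhs₂_one_div hNne] at this
    exact hasDerivWithinAt_matrix.1 this
  · intro t ht
    have hYX : ‖Y t - (0, Λ₁ t, Λ₂ t)‖ ≤ C * (c / N) :=
      (hY t ht).2.2.trans (mul_le_mul_of_nonneg_left hdist hC.le)
    have h1 : ‖(Y t).2.1 - Λ₁ t‖ ≤ C * (c / N) :=
      ((norm_fst_le _).trans (norm_snd_le _)).trans hYX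
    have h2 : ‖(Y t).2.2 - Λ₂ t‖ ≤ C * (c / N) :=
      ((norm_snd_le _).trans (norm_snd_le _)).trans hYX
    calc frob ((Y t).2.1 - Λ₁ t) + frob ((Y t).2.2 - Λ₂ t)
        ≤ n * (C * (c / N)) + n * (C * (c / N)) :=
          add_le_add ((frob_le_mul_norm _).trans (by gcongr)) ((frob_le_mul_norm _).trans (by gcongr))
      _ = 2 * n * C * c / N := by ring

end LQ
end
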